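/- Fix an enumeration ℚ = { r_k : k ≥ 1 } of the rationals, and set Φ_0 = id, I_0 = [0,1]. There exist strictly increasing sequences of positive integers (q_k) (with each q_k odd) and (n_k), and compact sets I_k ⊂ [0,1], such that, setting γ_k(t) = w_{n_k}·γ(q_k(t − j(n_k))), φ_k(t) = t + Σ_{p≥0} γ_k(t + p/q_k), Φ_k = φ_k ∘ ⋯ ∘ φ_1, h_k = ψ ∘ Φ_k ∘ ψ^{-1} on (0,∞) extended by h_k(0) = 0 (a C^∞ diffeomorphism of [0,∞) equal to the identity near 0), ξ_k = h_k^*ξ_0 (i.e. ξ_k(x) = ξ_0(h_k(x))/Dh_k(x)), and f_k^t the time-t flow of ξ_k, the following hold for every k ≥ 1: (i) ‖Φ_k − Φ_{k-1}‖_{k+1} ≤ 2^{−k−1}; (ii) ‖ξ_k − ξ_{k-1}‖₁ ≤ 2^{−k}; (iii) ‖f_k^t − f_{k-1}^t‖_k ≤ 2^{−k} for all t ∈ I_k ∪ {1}; where I_k ⊂ I_{k-1} is a compact set avoiding r_k and consisting of 2^k pairwise disjoint closed intervals of nonzero length, exactly two contained in each connected component of I_{k-1}. -/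

import Mathlib

open Set Filter Topology

/-- `f` is a diffeomorphism of the half-line `[0,∞)`: it fixes `0`, maps `[0,∞)` bijectively
onto itself, is differentiable (in the sense of `[0,∞)`) with everywhere positive derivative,
and its inverse is differentiable. -/
def HalfLineDiffeo (f : ℝ → ℝ) : Prop :=
  f 0 = 0 ∧ Set.BijOn f (Set.Ici 0) (Set.Ici 0) ∧
    (∀ x ∈ Set.Ici (0 : ℝ), ∃ d : ℝ, 0 < d ∧ HasDerivWithinAt f d (Set.Ici 0) x) ∧
    (∀ y ∈ Set.Ici (0 : ℝ), ∃ d : ℝ,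
      HasDerivWithinAt (Function.invFunOn f (Set.Ici 0)) d (Set.Ici 0) y)

/-- `f` is a `C^r` diffeomorphism of `[0,∞)`. -/
def CrHalfLineDiffeo (r : ℕ∞) (f : ℝ → ℝ) : Prop :=
  HalfLineDiffeo f ∧ ContDiffOn ℝ r f (Set.Ici 0)

/-- The `C^r` centralizer of `f` : all `C^r` diffeomorphisms of `[0,∞)` commuting with `f`. -/
def Centralizer (r : ℕ∞) (f : ℝ → ℝ) : Set (ℝ → ℝ) :=
  {g | CrHalfLineDiffeo r g ∧ ∀ x ∈ Set.Ici (0 : ℝ), g (f x) = f (g x)}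

/-- `F` is the (complete, globally defined) flow of the vector field `ξ` on `[0,∞)`:
`F 0 x = x` and `∂ₜ F t x = ξ (F t x)` for all `t ∈ ℝ` and `x ∈ [0,∞)`. -/
def IsFlowOf (ξ : ℝ → ℝ) (F : ℝ → ℝ → ℝ) : Prop :=
  ∀ x ∈ Set.Ici (0 : ℝ), F 0 x = x ∧
    ∀ t : ℝ, F t x ∈ Set.Ici (0 : ℝ) ∧ HasDerivAt (fun s => F s x) (ξ (F t x)) t

noncomputable def uSeq (n : ℕ) : ℝ := (2 : ℝ) ^ (-((n : ℤ) ^ 4))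
noncomputable def vSeq (n : ℕ) : ℝ := (2 : ℝ) ^ (-((n : ℤ) ^ 2))
noncomputable def wSeq (n : ℕ) : ℝ := (2 : ℝ) ^ (-((n : ℤ) ^ 3))

/-- The pair of auxiliary plateau functions `α, β` used to define the Sergeraert field. -/
def IsBumpPair (α β : ℝ → ℝ) : Prop :=
  ContDiff ℝ ((⊤ : ℕ∞) : WithTop ℕ∞) α ∧ ContDiff ℝ ((⊤ : ℕ∞) : WithTop ℕ∞) β ∧
  (∀ t : ℝ, α t ∈ Set.Icc (0 : ℝ) 1) ∧ (∀ t : ℝ, β t ∈ Set.Icc (0 : ℝ) 1) ∧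
  (∀ t : ℝ, t ≤ 1 / 6 → α t = 0) ∧ (∀ t : ℝ, 1 / 3 ≤ t → α t = 1) ∧
  (∀ t : ℝ, t ≤ 1 / 6 → β t = 0) ∧ (∀ t : ℝ, 5 / 6 ≤ t → β t = 0) ∧
  (∀ t ∈ Set.Icc (1 / 3 : ℝ) (2 / 3), β t = 1)

/-- The defining equations of the Sergeraert vector field `ξ₀` built from `α` and `β`. -/
def IsSergeraertField (α β ξ₀ : ℝ → ℝ) : Prop :=
  ξ₀ 0 = 0 ∧ (∀ x : ℝ, 1 ≤ x → ξ₀ x = -1) ∧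
  ∀ n : ℕ, ∀ x ∈ Set.Icc ((2 : ℝ) ^ (-(n : ℤ) - 1)) ((2 : ℝ) ^ (-(n : ℤ))),
    ξ₀ x = -uSeq (n + 1) - (uSeq n - uSeq (n + 1)) * α ((2 : ℝ) ^ (n + 1) * x - 1)
      - (vSeq n - uSeq n) * β ((2 : ℝ) ^ (n + 1) * x - 1)

/-- `Icur` is obtained from `Iprev` by the `k`-th step of the Cantor-set construction:
it is a compact subset of `Iprev` avoiding `rk`, consisting of `2^k` pairwise disjoint
closed intervals of nonzero length, exactly two of which lie in each connected component
of `Iprev`. -/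
def CantorStep (Iprev Icur : Set ℝ) (k : ℕ) (rk : ℝ) : Prop :=
  IsCompact Icur ∧ Icur ⊆ Iprev ∧ rk ∉ Icur ∧
  ∃ lo hi : Fin (2 ^ k) → ℝ,
    (∀ i, lo i < hi i) ∧
    (Pairwise fun i i' => Disjoint (Set.Icc (lo i) (hi i)) (Set.Icc (lo i') (hi i'))) ∧
    Icur = ⋃ i, Set.Icc (lo i) (hi i) ∧
    (∀ x ∈ Iprev,
      Nat.card {i : Fin (2 ^ k) //
        Set.Icc (lo i) (hi i) ⊆ connectedComponentIn Iprev x} = 2)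

/-- The defining equations of the approximation-by-conjugation construction:
`Φ_k = φ_k ∘ ⋯ ∘ φ_1` with `φ_k(t) = t + Σ_{p≥0} w_{n_k} γ(q_k(t + p/q_k − j(n_k)))`,
`h_k = ψ ∘ Φ_k ∘ ψ⁻¹` (extended by `h_k 0 = 0`), `ξ_k = h_k^* ξ₀`, and `F k` the flow
of `ξ_k`. -/
def ConstructionData (γ ψ ξ₀ : ℝ → ℝ) (j : ℕ → ℤ) (q n : ℕ → ℕ)
    (Φ h ξv : ℕ → ℝ → ℝ) (F : ℕ → ℝ → ℝ → ℝ) : Prop :=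
  Φ 0 = id ∧
  (∀ k : ℕ, Φ (k + 1) =
    (fun t => t + ∑' p : ℕ,
      wSeq (n (k + 1)) * γ ((q (k + 1) : ℝ) *
        (t + (p : ℝ) / (q (k + 1) : ℝ) - (j (n (k + 1)) : ℝ)))) ∘ Φ k) ∧
  (∀ k : ℕ, h k 0 = 0 ∧ ∀ t : ℝ, h k (ψ t) = ψ (Φ k t)) ∧
  (∀ k : ℕ, ∀ x ∈ Set.Ici (0 : ℝ),
    ξv k x = ξ₀ (h k x) / derivWithin (h k) (Set.Ici 0) x) ∧
  (∀ k : ℕ, IsFlowOf (ξv k) (F k))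

/-- The estimates (i), (ii), (iii) of the inductive lemma at step `k`:
`‖Φ_k − Φ_{k-1}‖_{k+1} ≤ 2^{−k−1}`, `‖ξ_k − ξ_{k-1}‖₁ ≤ 2^{−k}`, and
`‖f_k^t − f_{k-1}^t‖_k ≤ 2^{−k}` for all `t ∈ I_k ∪ {1}`. -/
def ConstructionEstimates (Φ ξv : ℕ → ℝ → ℝ) (F : ℕ → ℝ → ℝ → ℝ)
    (I : ℕ → Set ℝ) (k : ℕ) : Prop :=
  (∀ i ≤ k + 1, ∀ t : ℝ,
    |iteratedDeriv i (fun s => Φ k s - Φ (k - 1) s) t| ≤ (2 : ℝ) ^ (-(k : ℤ) - 1)) ∧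
  (∀ i ≤ 1, ∀ x ∈ Set.Ici (0 : ℝ),
    |iteratedDerivWithin i (fun y => ξv k y - ξv (k - 1) y) (Set.Ici 0) x| ≤
      (2 : ℝ) ^ (-(k : ℤ))) ∧
  (∀ t ∈ I k ∪ {(1 : ℝ)}, ∀ i ≤ k, ∀ x ∈ Set.Ici (0 : ℝ),
    |iteratedDerivWithin i (fun y => F k t y - F (k - 1) t y) (Set.Ici 0) x| ≤
      (2 : ℝ) ^ (-(k : ℤ)))

/-- The `m`-th derivatives of the family `f` are uniformly bounded on `S`. -/
def UnifDerivBdd {ι : Type*} (S : Set ℝ) (f : ι → ℝ → ℝ) (m : ℕ) : Prop :=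
  ∃ C : ℝ, ∀ i, ∀ x ∈ S, |iteratedDeriv m (f i) x| ≤ C

/-- A family of smooth functions on `S` all of whose derivatives, of each order `m ≥ 0`, are
uniformly bounded. -/
structure UnifBdd {ι : Type*} (S : Set ℝ) (f : ι → ℝ → ℝ) : Prop where
  smooth : ∀ i, ContDiffOn ℝ ((⊤ : ℕ∞) : WithTop ℕ∞) (f i) S
  bdd : ∀ m, UnifDerivBdd S f m

/-- A family of smooth functions on `S` all of whose derivatives, of each order `m ≥ 1`, are
uniformly bounded. -/
structure UnifTame {ι : Type*} (S : Set ℝ) (f : ι → ℝ → ℝ) : Prop where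
  smooth : ∀ i, ContDiffOn ℝ ((⊤ : ℕ∞) : WithTop ℕ∞) (f i) S
  bdd : ∀ m, UnifDerivBdd S f (m + 1)

section UniformBounds

variable {ι κ : Type*} {S S' : Set ℝ} {f g : ι → ℝ → ℝ} {m : ℕ}

theorem norm_iteratedFDerivWithin_eq_abs_iteratedDeriv (hS : IsOpen S) (f : ℝ → ℝ) (m : ℕ)
    {x : ℝ} (hx : x ∈ S) :
    ‖iteratedFDerivWithin ℝ m f S x‖ = |iteratedDeriv m f x| := by
  rw [norm_iteratedFDerivWithin_eq_norm_iteratedDerivWithin,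
    iteratedDerivWithin_of_isOpen hS hx, Real.norm_eq_abs]

theorem exists_common_bound (P : ℕ → ℝ → Prop) (hP : ∀ l C C', C ≤ C' → P l C → P l C')
    (m : ℕ) (h : ∀ l ≤ m, ∃ C, P l C) : ∃ C, 1 ≤ C ∧ ∀ l ≤ m, P l C := by
  induction m with
  | zero =>
    obtain ⟨C, hC⟩ := h 0 le_rfl
    refine ⟨max 1 C, le_max_left _ _, fun l hl => ?_⟩
    obtain rfl : l = 0 := by omega
    exact hP _ _ _ (le_max_right _ _) hC
  | succ m ih =>
    obtain ⟨C, h1, hC⟩ := ih fun l hl => h l (by omega)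
    obtain ⟨C', hC'⟩ := h (m + 1) le_rfl
    refine ⟨max C C', h1.trans (le_max_left _ _), fun l hl => ?_⟩
    rcases Nat.lt_or_ge m l with hlt | hle
    · obtain rfl : l = m + 1 := by omega
      exact hP _ _ _ (le_max_right _ _) hC'
    · exact hP _ _ _ (le_max_left _ _) (hC l hle)

theorem UnifDerivBdd.exists_common (h : ∀ l ≤ m, UnifDerivBdd S f l) :
    ∃ C, 1 ≤ C ∧ ∀ l ≤ m, ∀ i, ∀ x ∈ S, |iteratedDeriv l (f i) x| ≤ C :=
  exists_common_bound (fun l C => ∀ i, ∀ x ∈ S, |iteratedDeriv l (f i) x| ≤ C)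
    (fun _ _ _ hC h i x hx => (h i x hx).trans hC) m h

theorem UnifDerivBdd.comp (hS : IsOpen S) (hS' : IsOpen S')
    (hg : ∀ i, ContDiffOn ℝ ((⊤ : ℕ∞) : WithTop ℕ∞) (g i) S')
    (hf : ∀ i, ContDiffOn ℝ ((⊤ : ℕ∞) : WithTop ℕ∞) (f i) S)
    (hm : ∀ i, MapsTo (f i) S S')
    (hgb : ∀ l ≤ m, UnifDerivBdd S' g l) (hfb : ∀ l, l + 1 ≤ m → UnifDerivBdd S f (l + 1)) :
    UnifDerivBdd S (fun i => g i ∘ f i) m := by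
  obtain ⟨C, -, hC⟩ := UnifDerivBdd.exists_common hgb
  obtain ⟨D, hD1, hD⟩ := exists_common_bound
    (fun l C => 1 ≤ l → ∀ i, ∀ x ∈ S, |iteratedDeriv l (f i) x| ≤ C)
    (fun _ _ _ hC h hl i x hx => (h hl i x hx).trans hC) m (fun l hl => by
      rcases l with _ | l
      · exact ⟨0, fun h => absurd h (by omega)⟩
      · obtain ⟨C, hC⟩ := hfb l hl
        exact ⟨C, fun _ => hC⟩)
  refine ⟨m.factorial * C * D ^ m, fun i x hx => ?_⟩
  rw [← norm_iteratedFDerivWithin_eq_abs_iteratedDeriv hS _ _ hx]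
  refine norm_iteratedFDerivWithin_comp_le (hg i) (hf i) (by exact_mod_cast le_top)
    hS'.uniqueDiffOn hS.uniqueDiffOn (hm i) hx (fun l hl => ?_) (fun l h1 hl => ?_)
  · rw [norm_iteratedFDerivWithin_eq_abs_iteratedDeriv hS' _ _ (hm i hx)]
    exact hC l hl i _ (hm i hx)
  · rw [norm_iteratedFDerivWithin_eq_abs_iteratedDeriv hS _ _ hx]
    exact (hD l hl h1 i x hx).trans (le_self_pow₀ hD1 (by omega))

theorem UnifDerivBdd.mul (hS : IsOpen S)
    (hf : ∀ i, ContDiffOn ℝ ((⊤ : ℕ∞) : WithTop ℕ∞) (f i) S)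
    (hg : ∀ i, ContDiffOn ℝ ((⊤ : ℕ∞) : WithTop ℕ∞) (g i) S)
    (hfb : ∀ l ≤ m, UnifDerivBdd S f l) (hgb : ∀ l ≤ m, UnifDerivBdd S g l) :
    UnifDerivBdd S (fun i x => f i x * g i x) m := by
  obtain ⟨C, hC1, hC⟩ := UnifDerivBdd.exists_common hfb
  obtain ⟨D, hD1, hD⟩ := UnifDerivBdd.exists_common hgb
  refine ⟨∑ l ∈ Finset.range (m + 1), (m.choose l : ℝ) * C * D, fun i x hx => ?_⟩
  rw [← norm_iteratedFDerivWithin_eq_abs_iteratedDeriv hS _ _ hx]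
  refine (norm_iteratedFDerivWithin_mul_le (hf i) (hg i) hS.uniqueDiffOn hx
    (by exact_mod_cast le_top)).trans (Finset.sum_le_sum fun l hl => ?_)
  rw [norm_iteratedFDerivWithin_eq_abs_iteratedDeriv hS _ _ hx,
    norm_iteratedFDerivWithin_eq_abs_iteratedDeriv hS _ _ hx]
  have hl' : l ≤ m := by simpa [Nat.lt_succ_iff] using hl
  gcongr
  · exact hC l hl' i x hx
  · exact hD (m - l) (by omega) i x hx

theorem UnifDerivBdd.congr (hS : IsOpen S) (hf : UnifDerivBdd S f m)
    (h : ∀ i, EqOn (g i) (f i) S) : UnifDerivBdd S g m := by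
  obtain ⟨C, hC⟩ := hf
  refine ⟨C, fun i x hx => ?_⟩
  rw [((h i).eventuallyEq_of_mem (hS.mem_nhds hx)).iteratedDeriv_eq]
  exact hC i x hx

theorem UnifDerivBdd.of_deriv (hS : IsOpen S) {f' : ι → ℝ → ℝ}
    (hd : ∀ i, ∀ x ∈ S, HasDerivAt (f i) (f' i x) x) (h : UnifDerivBdd S f' m) :
    UnifDerivBdd S f (m + 1) := by
  obtain ⟨C, hC⟩ := h.congr (g := fun i => deriv (f i)) hS fun i x hx => (hd i x hx).deriv
  exact ⟨C, fun i x hx => by rw [iteratedDeriv_succ']; exact hC i x hx⟩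

theorem UnifBdd.congr (hS : IsOpen S) (hf : UnifBdd S f) (h : ∀ i, EqOn (g i) (f i) S) :
    UnifBdd S g :=
  ⟨fun i => (hf.smooth i).congr fun _ hx => h i hx, fun m => (hf.bdd m).congr hS h⟩

theorem UnifTame.congr (hS : IsOpen S) (hf : UnifTame S f) (h : ∀ i, EqOn (g i) (f i) S) :
    UnifTame S g :=
  ⟨fun i => (hf.smooth i).congr fun _ hx => h i hx, fun m => (hf.bdd m).congr hS h⟩

theorem UnifBdd.tame (hf : UnifBdd S f) : UnifTame S f := ⟨hf.smooth, fun m => hf.bdd (m + 1)⟩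

theorem UnifTame.reindex (hf : UnifTame S f) (e : κ → ι) : UnifTame S (fun k => f (e k)) :=
  ⟨fun _ => hf.smooth _, fun m => (hf.bdd m).imp fun _ hC k => hC (e k)⟩

theorem UnifTame.mono (hf : UnifTame S f) (h : S' ⊆ S) : UnifTame S' f :=
  ⟨fun k => (hf.smooth k).mono h, fun m => (hf.bdd m).imp fun _ hC k x hx => hC k x (h hx)⟩

theorem UnifTame.deriv (hS : IsOpen S) (hf : UnifTame S f) :
    UnifBdd S (fun i => deriv (f i)) :=
  ⟨fun i => (hf.smooth i).deriv_of_isOpen hS (by norm_cast), fun m => by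
    simpa only [UnifDerivBdd, iteratedDeriv_succ'] using hf.bdd m⟩

theorem UnifTame.hasDerivAt (hS : IsOpen S) (hf : UnifTame S f) (i : ι) {x : ℝ} (hx : x ∈ S) :
    HasDerivAt (f i) (_root_.deriv (f i) x) x :=
  (((hf.smooth i).contDiffAt (hS.mem_nhds hx)).differentiableAt (by simp)).hasDerivAt

theorem UnifBdd.exists_bound (hf : UnifBdd S f) : ∃ C, ∀ i, ∀ x ∈ S, |f i x| ≤ C := by
  simpa [UnifDerivBdd] using hf.bdd 0

theorem UnifTame.of_deriv (hS : IsOpen S) {f' : ι → ℝ → ℝ}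
    (hd : ∀ i, ∀ x ∈ S, HasDerivAt (f i) (f' i x) x) (h : UnifBdd S f') : UnifTame S f := by
  refine ⟨fun i => ?_, fun m => (h.bdd m).of_deriv hS hd⟩
  refine (contDiffOn_infty_iff_deriv_of_isOpen hS).2
    ⟨fun x hx => (hd i x hx).differentiableAt.differentiableWithinAt, ?_⟩
  exact (h.smooth i).congr fun x hx => (hd i x hx).deriv

theorem unifBdd_const (c : ι → ℝ) {C : ℝ} (hc : ∀ i, |c i| ≤ C) :
    UnifBdd S (fun i _ => c i) :=
  ⟨fun _ => contDiffOn_const, fun m => ⟨C, fun i x _ => by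
    rw [iteratedDeriv_const]
    split_ifs
    · exact hc i
    · simpa using (abs_nonneg _).trans (hc i)⟩⟩

theorem unifTame_id_add_const (c : ι → ℝ) (hS : IsOpen S) : UnifTame S (fun i x => x + c i) :=
  UnifTame.of_deriv hS (f' := fun _ _ => 1) (fun i x _ => (hasDerivAt_id x).add_const (c i))
    (unifBdd_const (fun _ => 1) (C := 1) (by simp))

theorem UnifBdd.comp (hS : IsOpen S) (hS' : IsOpen S') (hg : UnifBdd S' g)
    (hf : UnifTame S f) (hm : ∀ i, MapsTo (f i) S S') : UnifBdd S (fun i => g i ∘ f i) :=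
  ⟨fun i => (hg.smooth i).comp (hf.smooth i) (hm i), fun _ => .comp hS hS' hg.smooth hf.smooth hm
    (fun l _ => hg.bdd l) (fun l _ => hf.bdd l)⟩

theorem UnifBdd.mul (hS : IsOpen S) (hf : UnifBdd S f) (hg : UnifBdd S g) :
    UnifBdd S (fun i x => f i x * g i x) :=
  ⟨fun i => (hf.smooth i).mul (hg.smooth i), fun _ => .mul hS hf.smooth hg.smooth
    (fun l _ => hf.bdd l) (fun l _ => hg.bdd l)⟩

theorem UnifTame.comp (hS : IsOpen S) (hS' : IsOpen S') (hg : UnifTame S' g)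
    (hf : UnifTame S f) (hm : ∀ i, MapsTo (f i) S S') : UnifTame S (fun i => g i ∘ f i) :=
  UnifTame.of_deriv hS
    (fun i _ hx => (hg.hasDerivAt hS' i (hm i hx)).comp _ (hf.hasDerivAt hS i hx))
    (((hg.deriv hS').comp hS hS' hf hm).mul hS (hf.deriv hS))

theorem UnifBdd.add (hS : IsOpen S) (hf : UnifBdd S f) (hg : UnifBdd S g) :
    UnifBdd S (fun i x => f i x + g i x) := by
  refine ⟨fun i => (hf.smooth i).add (hg.smooth i), fun m => ?_⟩
  obtain ⟨C, hC⟩ := hf.bdd m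
  obtain ⟨D, hD⟩ := hg.bdd m
  refine ⟨C + D, fun i x hx => ?_⟩
  rw [iteratedDeriv_fun_add (((hf.smooth i).contDiffAt (hS.mem_nhds hx)).of_le
    (by exact_mod_cast le_top)) (((hg.smooth i).contDiffAt (hS.mem_nhds hx)).of_le
    (by exact_mod_cast le_top))]
  exact (abs_add_le _ _).trans (add_le_add (hC i x hx) (hD i x hx))

theorem UnifTame.add (hS : IsOpen S) (hf : UnifTame S f) (hg : UnifTame S g) :
    UnifTame S (fun i x => f i x + g i x) :=
  UnifTame.of_deriv hS (fun i _ hx => (hf.hasDerivAt hS i hx).add (hg.hasDerivAt hS i hx))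
    ((hf.deriv hS).add hS (hg.deriv hS))

theorem UnifBdd.const_mul (hS : IsOpen S) (c : ι → ℝ) {C : ℝ} (hc : ∀ i, |c i| ≤ C)
    (hf : UnifBdd S f) : UnifBdd S (fun i x => c i * f i x) :=
  (unifBdd_const c hc).mul hS hf

theorem UnifBdd.sub (hS : IsOpen S) (hf : UnifBdd S f) (hg : UnifBdd S g) :
    UnifBdd S (fun i x => f i x - g i x) :=
  (hf.add hS (hg.const_mul hS (fun _ => -1) (C := 1) (by simp))).congr hS
    fun i x _ => by ring

theorem unifBdd_inv {c : ℝ} (hc : 0 < c) :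
    UnifBdd {y : ℝ | c < |y|} (fun _ : ι => fun y : ℝ => y⁻¹) := by
  have h0 : ∀ y ∈ {y : ℝ | c < |y|}, y ≠ 0 := fun y hy => abs_pos.1 (hc.trans hy)
  refine ⟨fun _ => contDiffOn_id.inv h0, fun m => ⟨m.factorial * (c ^ (m + 1))⁻¹,
    fun _ y hy => ?_⟩⟩
  have hy' : c < |y| := hy
  rw [iteratedDeriv_eq_iterate, iter_deriv_inv, abs_mul, abs_mul, abs_pow, abs_neg, abs_one,
    one_pow, one_mul, Nat.abs_cast, show (-1 - (m : ℤ)) = -((m + 1 : ℕ) : ℤ) by push_cast; ring,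
    zpow_neg, zpow_natCast, abs_inv, abs_pow]
  gcongr

theorem UnifBdd.inv (hS : IsOpen S) (hf : UnifBdd S f) {c : ℝ} (hc : 0 < c)
    (h : ∀ i, ∀ x ∈ S, c ≤ |f i x|) : UnifBdd S (fun i x => (f i x)⁻¹) :=
  (unifBdd_inv (half_pos hc)).comp hS (isOpen_lt continuous_const continuous_abs) hf.tame
    fun i x hx => (half_lt_self hc).trans_le (h i x hx)

theorem contDiffOn_of_hasDerivAt_comp {H f : ℝ → ℝ} (hS : IsOpen S)
    (hH : ContDiffOn ℝ ((⊤ : ℕ∞) : WithTop ℕ∞) H S') (hm : MapsTo f S S')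
    (hd : ∀ x ∈ S, HasDerivAt f (H (f x)) x) :
    ContDiffOn ℝ ((⊤ : ℕ∞) : WithTop ℕ∞) f S := by
  refine contDiffOn_infty.2 fun n => ?_
  induction n with
  | zero =>
    exact contDiffOn_zero.2 fun x hx => (hd x hx).continuousAt.continuousWithinAt
  | succ n ih =>
    have := (contDiffOn_succ_iff_deriv_of_isOpen (𝕜 := ℝ) (n := (n : WithTop ℕ∞))
      (f := f) hS).2 ⟨fun x hx => (hd x hx).differentiableAt.differentiableWithinAt, by simp,
        ((hH.of_le (by exact_mod_cast le_top)).comp ih hm).congr fun x hx => (hd x hx).deriv⟩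
    exact_mod_cast this

/-- A family of solutions of autonomous equations `f' = H ∘ f` with uniformly bounded
right-hand sides is uniformly tame. -/
theorem UnifTame.of_hasDerivAt_comp {H : ι → ℝ → ℝ} (hS : IsOpen S) (hS' : IsOpen S')
    (hH : UnifBdd S' H) (hm : ∀ i, MapsTo (f i) S S')
    (hd : ∀ i, ∀ x ∈ S, HasDerivAt (f i) (H i (f i x)) x) : UnifTame S f := by
  have hs := fun i => contDiffOn_of_hasDerivAt_comp hS (hH.smooth i) (hm i) (hd i)
  refine ⟨hs, fun m => ?_⟩
  induction m using Nat.strong_induction_on with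
  | _ m ih =>
    exact .of_deriv hS hd (.comp hS hS' hH.smooth hs hm (fun l _ => hH.bdd l)
      fun l hl => ih l (by omega))

end UniformBounds

theorem unifBdd_of_isCompact {ι : Type*} {S U K : Set ℝ} {f : ℝ → ℝ} (hU : IsOpen U)
    (hf : ContDiffOn ℝ ((⊤ : ℕ∞) : WithTop ℕ∞) f U) (hSU : S ⊆ U) (hK : IsCompact K)
    (hKU : K ⊆ U) {b : ℝ} (h : ∀ x ∈ S, x ∉ K → f =ᶠ[𝓝 x] fun _ => b) :
    UnifBdd S (fun _ : ι => f) := by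
  refine ⟨fun _ => hf.mono hSU, fun m => ?_⟩
  have hc : ContinuousOn (fun x => |iteratedDeriv m f x|) K := by
    refine ContinuousOn.abs (ContinuousOn.mono ?_ hKU)
    refine (hf.continuousOn_iteratedDerivWithin (m := m) (by exact_mod_cast le_top)
      hU.uniqueDiffOn).congr fun x hx => ?_
    exact (iteratedDerivWithin_of_isOpen hU hx).symm
  obtain ⟨C, hC⟩ := hK.bddAbove_image hc
  refine ⟨max C |b|, fun _ x hx => ?_⟩
  by_cases hxK : x ∈ K
  · exact (hC ⟨x, hxK, rfl⟩).trans (le_max_left _ _)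
  · rw [(h x hx hxK).iteratedDeriv_eq, iteratedDeriv_const]
    split_ifs
    · exact le_max_right _ _
    · simp

/-! ### Diffeomorphisms of the line with derivative bounded below -/

section Inverse

theorem surjective_of_le_deriv {f : ℝ → ℝ} (hf : Differentiable ℝ f) {c : ℝ} (hc : 0 < c)
    (h : ∀ x, c ≤ deriv f x) : Function.Surjective f := by
  have key : ∀ x y, x ≤ y → c * (y - x) ≤ f y - f x := fun x y hxy =>
    mul_sub_le_image_sub_of_le_deriv hf h hxy
  refine hf.continuous.surjective ?_ ?_
  · refine tendsto_atTop_mono' _ (f₁ := fun x => c * x + f 0) ?_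
      (tendsto_atTop_add_const_right _ _ (tendsto_id.const_mul_atTop hc))
    filter_upwards [eventually_ge_atTop 0] with x hx
    have := key 0 x hx
    simp only [sub_zero] at this
    linarith
  · refine tendsto_atBot_mono' _ (f₁ := fun x => c * x + f 0) ?_
      (tendsto_atBot_add_const_right _ _ (tendsto_id.const_mul_atBot hc))
    filter_upwards [eventually_le_atBot 0] with x hx
    have := key x 0 hx
    simp only [zero_sub] at this
    linarith

theorem strictMono_of_le_deriv {f : ℝ → ℝ} {c : ℝ} (hc : 0 < c)
    (h : ∀ x, c ≤ deriv f x) : StrictMono f :=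
  strictMono_of_deriv_pos fun x => hc.trans_le (h x)

theorem hasDerivAt_rightInverse {f g : ℝ → ℝ} (hf : Differentiable ℝ f) {c : ℝ} (hc : 0 < c)
    (h : ∀ x, c ≤ deriv f x) (hg : ∀ x, f (g x) = x) (x : ℝ) :
    HasDerivAt g (deriv f (g x))⁻¹ x := by
  have hmono := strictMono_of_le_deriv hc h
  have hgm : StrictMono g := fun x y hxy => hmono.lt_iff_lt.1 (by simpa [hg] using hxy)
  have hgs : Function.Surjective g := fun x => ⟨f x, hmono.injective (hg _)⟩
  exact (hf _).hasDerivAt.of_local_left_inverse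
    (hgm.monotone.continuous_of_surjective hgs).continuousAt (hc.trans_le (h _)).ne'
    (Eventually.of_forall hg)

theorem UnifTame.rightInverse {ι : Type*} {f g : ι → ℝ → ℝ} (hf : UnifTame univ f) {c : ℝ}
    (hc : 0 < c) (h : ∀ i x, c ≤ _root_.deriv (f i) x) (hg : ∀ i x, f i (g i x) = x) :
    UnifTame univ g := by
  have hd : ∀ i, Differentiable ℝ (f i) := fun i x =>
    (hf.hasDerivAt isOpen_univ i (mem_univ x)).differentiableAt
  exact .of_hasDerivAt_comp isOpen_univ isOpen_univ
    ((hf.deriv isOpen_univ).inv isOpen_univ hc fun i x _ => (h i x).trans (le_abs_self _))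
    (fun i => mapsTo_univ _ _) fun i x _ => hasDerivAt_rightInverse (hd i) hc (h i) (hg i) x

/-- Diffeomorphisms of the line that are the identity near `+∞`, with bounded derivatives of each
positive order and derivative bounded away from zero. -/
structure TameDiffeo (Φ : ℝ → ℝ) : Prop where
  tame : UnifTame univ (fun _ : Unit => Φ)
  lower : ∃ c > 0, ∀ t, c ≤ deriv Φ t
  ident : ∃ T, ∀ t ≥ T, Φ t = t

variable {Φ : ℝ → ℝ}

namespace TameDiffeo

theorem differentiable (h : TameDiffeo Φ) : Differentiable ℝ Φ := fun x =>
  (h.tame.hasDerivAt isOpen_univ () (mem_univ x)).differentiableAt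

theorem deriv_pos (h : TameDiffeo Φ) (t : ℝ) : 0 < deriv Φ t :=
  let ⟨_, hc, hb⟩ := h.lower
  hc.trans_le (hb t)

theorem strictMono (h : TameDiffeo Φ) : StrictMono Φ := strictMono_of_deriv_pos h.deriv_pos

theorem apply_invFun (h : TameDiffeo Φ) (t : ℝ) : Φ (Function.invFun Φ t) = t :=
  let ⟨_, hc, hb⟩ := h.lower
  Function.rightInverse_invFun (surjective_of_le_deriv h.differentiable hc hb) t

theorem invFun_apply (h : TameDiffeo Φ) (t : ℝ) : Function.invFun Φ (Φ t) = t :=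
  Function.leftInverse_invFun h.strictMono.injective t

theorem hasDerivAt_invFun (h : TameDiffeo Φ) (t : ℝ) :
    HasDerivAt (Function.invFun Φ) (deriv Φ (Function.invFun Φ t))⁻¹ t :=
  let ⟨_, hc, hb⟩ := h.lower
  hasDerivAt_rightInverse h.differentiable hc hb h.apply_invFun t

theorem tame_invFun (h : TameDiffeo Φ) : UnifTame univ (fun _ : Unit => Function.invFun Φ) :=
  let ⟨_, hc, hb⟩ := h.lower
  h.tame.rightInverse hc (fun _ => hb) fun _ => h.apply_invFun

theorem strictMono_invFun (h : TameDiffeo Φ) : StrictMono (Function.invFun Φ) :=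
  fun x y hxy => h.strictMono.lt_iff_lt.1 (by simpa [h.apply_invFun] using hxy)

theorem invFun_eq_self (h : TameDiffeo Φ) {t : ℝ} (ht : Φ t = t) : Function.invFun Φ t = t := by
  conv_lhs => rw [← ht]
  exact h.invFun_apply t

end TameDiffeo

theorem tameDiffeo_id : TameDiffeo id :=
  ⟨(unifTame_id_add_const (fun _ => 0) isOpen_univ).congr isOpen_univ fun _ x _ => by simp,
    ⟨1, one_pos, fun t => by simp⟩, ⟨0, fun _ _ => rfl⟩⟩

end Inverse

/-! ### The half-infinite sum of translates of a bump -/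

/-- `u ↦ ∑_{p ≥ 0} γ (u + p)`. -/
noncomputable def shiftSum (γ : ℝ → ℝ) (u : ℝ) : ℝ := ∑' p : ℕ, γ (u + p)

section ShiftSum

variable {γ : ℝ → ℝ}

theorem shiftSum_eq (hγ : ∀ t : ℝ, t ∉ Icc (-(1 / 4) : ℝ) (1 / 4) → γ t = 0) {u : ℝ} {z : ℤ}
    (h : |u - z| < 3 / 4) : shiftSum γ u = if z ≤ 0 then γ (u - z) else 0 := by
  have hout : ∀ p : ℕ, (p : ℤ) ≠ -z → γ (u + p) = 0 := by
    refine fun p hp => hγ _ fun hmem => ?_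
    rw [abs_lt] at h
    rcases lt_or_gt_of_ne hp with hlt | hlt
    · have : (p : ℝ) ≤ -z - 1 := by exact_mod_cast (by omega : (p : ℤ) ≤ -z - 1)
      linarith [hmem.1]
    · have : (-z + 1 : ℝ) ≤ p := by exact_mod_cast (by omega : -z + 1 ≤ (p : ℤ))
      linarith [hmem.2]
  unfold shiftSum
  split_ifs with hz
  · rw [tsum_eq_single (-z).toNat fun p hp => hout p (by omega)]
    congr 1
    have : (((-z).toNat : ℤ) : ℝ) = ((-z : ℤ) : ℝ) := by rw [Int.toNat_of_nonneg (by omega)]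
    push_cast at this
    linarith
  · rw [tsum_congr fun p => hout p (by omega), tsum_zero]

theorem shiftSum_add_nat (hγ : ∀ t : ℝ, t ∉ Icc (-(1 / 4) : ℝ) (1 / 4) → γ t = 0)
    {u : ℝ} (m : ℕ) (h : u + m ≤ 0) :
    shiftSum γ (u + m) = shiftSum γ u := by
  have hr := abs_sub_round u
  have hz : round u + m ≤ 0 := by
    have h1 : (round u : ℝ) + m < 1 := by
      have := (abs_le.1 hr).1
      linarith
    have h2 : round u + (m : ℤ) < 1 := by exact_mod_cast h1
    omega
  rw [shiftSum_eq hγ (u := u) (z := round u) (by linarith),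
    shiftSum_eq hγ (z := round u + m) (by push_cast; rw [add_sub_add_right_eq_sub]; linarith),
    if_pos hz, if_pos (by omega)]
  push_cast
  rw [add_sub_add_right_eq_sub]

theorem shiftSum_of_one_le (hγ : ∀ t : ℝ, t ∉ Icc (-(1 / 4) : ℝ) (1 / 4) → γ t = 0)
    {u : ℝ} (h : 1 ≤ u) : shiftSum γ u = 0 := by
  have hr := abs_sub_round u
  rw [shiftSum_eq hγ (z := round u) (by linarith), if_neg]
  intro hz
  have : (round u : ℝ) ≤ 0 := by exact_mod_cast hz
  have := (abs_le.1 hr).2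
  linarith

theorem unifBdd_shiftSum (hγ : ∀ t : ℝ, t ∉ Icc (-(1 / 4) : ℝ) (1 / 4) → γ t = 0)
    (hs : ContDiff ℝ ((⊤ : ℕ∞) : WithTop ℕ∞) γ) {ι : Type*} :
    UnifBdd univ (fun _ : ι => shiftSum γ) := by
  have hloc : ∀ u, shiftSum γ =ᶠ[𝓝 u]
      fun y => if round u ≤ 0 then γ (y - round u) else 0 := by
    intro u
    have : ∀ᶠ y : ℝ in 𝓝 u, |y - round u| < 3 / 4 :=
      ContinuousAt.eventually_lt (by fun_prop) continuousAt_const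
        ((abs_sub_round u).trans_lt (by norm_num))
    exact this.mono fun y hy => shiftSum_eq hγ hy
  have hγb : UnifBdd univ (fun _ : Unit => γ) := by
    refine unifBdd_of_isCompact isOpen_univ hs.contDiffOn (subset_univ _)
      (isCompact_Icc (a := -(1 / 4)) (b := 1 / 4)) (subset_univ _) (b := 0) fun x _ hx => ?_
    exact Filter.mem_of_superset (isClosed_Icc.isOpen_compl.mem_nhds hx) fun y hy => hγ y hy
  refine ⟨fun _ => contDiffOn_univ.2 (contDiff_iff_contDiffAt.2 fun u => ?_), fun m => ?_⟩
  · refine ContDiffAt.congr_of_eventuallyEq ?_ (hloc u)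
    split_ifs
    · exact (hs.comp (contDiff_id.sub contDiff_const)).contDiffAt
    · exact contDiffAt_const
  · obtain ⟨C, hC⟩ := hγb.bdd m
    refine ⟨C, fun _ u _ => ?_⟩
    rw [(hloc u).iteratedDeriv_eq]
    split_ifs
    · rw [iteratedDeriv_comp_sub_const]
      exact hC () _ (mem_univ _)
    · rw [iteratedDeriv_const]
      simpa using (abs_nonneg _).trans (hC () 0 (mem_univ _))

end ShiftSum

/-! ### Conjugation by the time chart of a contracting field on the half-line -/

/-- `ψ` is the time chart of a smooth field `ξ₀` on `[0,∞)` which is negative on `(0,∞)`, vanishes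
at `0` and equals `-1` on `[1,∞)`. -/
structure TimeChart (ξ₀ ψ : ℝ → ℝ) : Prop where
  smooth : ContDiffOn ℝ ((⊤ : ℕ∞) : WithTop ℕ∞) ξ₀ (Ici 0)
  zero : ξ₀ 0 = 0
  neg : ∀ x : ℝ, 0 < x → ξ₀ x < 0
  far : ∀ x : ℝ, 1 ≤ x → ξ₀ x = -1
  deriv : ∀ t, HasDerivAt ψ (ξ₀ (ψ t)) t
  bij : BijOn ψ univ (Ioi 0)

/-- `ψ ∘ Φ ∘ ψ⁻¹` on `(0,∞)`, extended by `0`. -/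
noncomputable def conjHalfLine (ψ Φ : ℝ → ℝ) (x : ℝ) : ℝ :=
  if 0 < x then ψ (Φ (Function.invFun ψ x)) else 0

/-- The pull-back of `ξ₀` by `conjHalfLine ψ Φ`. -/
noncomputable def conjField (ξ₀ ψ Φ : ℝ → ℝ) (x : ℝ) : ℝ :=
  ξ₀ (conjHalfLine ψ Φ x) / derivWithin (conjHalfLine ψ Φ) (Ici 0) x

/-- The flow of `conjField ξ₀ ψ Φ`. -/
noncomputable def conjFlow (ψ Φ : ℝ → ℝ) (s : ℝ) : ℝ → ℝ :=
  conjHalfLine ψ fun t => Function.invFun Φ (Φ t + s)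

namespace TimeChart

variable {ξ₀ ψ Φ : ℝ → ℝ}

theorem pos (hc : TimeChart ξ₀ ψ) (t : ℝ) : 0 < ψ t := hc.bij.mapsTo (mem_univ t)

theorem field_neg (hc : TimeChart ξ₀ ψ) (t : ℝ) : ξ₀ (ψ t) < 0 := hc.neg _ (hc.pos t)

theorem strictAnti (hc : TimeChart ξ₀ ψ) : StrictAnti ψ :=
  strictAnti_of_deriv_neg fun t => by rw [(hc.deriv t).deriv]; exact hc.field_neg t

theorem invFun_apply (hc : TimeChart ξ₀ ψ) (t : ℝ) : Function.invFun ψ (ψ t) = t :=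
  Function.leftInverse_invFun hc.strictAnti.injective t

theorem exists_eq (hc : TimeChart ξ₀ ψ) {x : ℝ} (hx : 0 < x) : ∃ t, ψ t = x :=
  let ⟨t, _, ht⟩ := hc.bij.surjOn hx
  ⟨t, ht⟩

theorem apply_invFun (hc : TimeChart ξ₀ ψ) {x : ℝ} (hx : 0 < x) :
    ψ (Function.invFun ψ x) = x :=
  Function.invFun_eq (hc.exists_eq hx)

theorem conj_apply (hc : TimeChart ξ₀ ψ) (Φ : ℝ → ℝ) (t : ℝ) :
    conjHalfLine ψ Φ (ψ t) = ψ (Φ t) := by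
  rw [conjHalfLine, if_pos (hc.pos t), hc.invFun_apply]

theorem _root_.conjHalfLine_zero (ψ Φ : ℝ → ℝ) : conjHalfLine ψ Φ 0 = 0 := by
  simp [conjHalfLine]

theorem strictAntiOn_invFun (hc : TimeChart ξ₀ ψ) :
    StrictAntiOn (Function.invFun ψ) (Ioi 0) := fun x hx y hy hxy =>
  hc.strictAnti.lt_iff_gt.1 (by rwa [hc.apply_invFun hx, hc.apply_invFun hy])

theorem hasDerivAt_invFun (hc : TimeChart ξ₀ ψ) {x : ℝ} (hx : 0 < x) :
    HasDerivAt (Function.invFun ψ) (ξ₀ x)⁻¹ x := by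
  have hnhds : Ioi (0 : ℝ) ∈ 𝓝 x := Ioi_mem_nhds hx
  have hcont : ContinuousAt (fun y => -Function.invFun ψ y) x := by
    refine continuousAt_of_monotoneOn_of_image_mem_nhds (s := Ioi 0)
      (fun y hy z hz hyz => neg_le_neg (hc.strictAntiOn_invFun.antitoneOn hy hz hyz)) hnhds ?_
    convert univ_mem
    refine eq_univ_of_forall fun t => ⟨ψ (-t), hc.pos _, ?_⟩
    simp [hc.invFun_apply]
  have hd := hc.deriv (Function.invFun ψ x)
  rw [hc.apply_invFun hx] at hd
  exact hd.of_local_left_inverse (by simpa only [Pi.neg_def, neg_neg] using hcont.neg)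
    (hc.neg x hx).ne
    (Filter.mem_of_superset hnhds fun y hy => hc.apply_invFun hy)

theorem smooth_Ioi (hc : TimeChart ξ₀ ψ) :
    ContDiffOn ℝ ((⊤ : ℕ∞) : WithTop ℕ∞) ξ₀ (Ioi 0) := hc.smooth.mono Ioi_subset_Ici_self

theorem unifBdd_field (hc : TimeChart ξ₀ ψ) {c : ℝ} (h : 0 < c) :
    UnifBdd (Ioi c) (fun _ : Unit => ξ₀) := by
  refine unifBdd_of_isCompact isOpen_Ioi hc.smooth_Ioi (Ioi_subset_Ioi h.le)
    (isCompact_Icc (a := c) (b := 1)) (fun x hx => h.trans_le hx.1) (b := -1) fun x hx hxK => ?_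
  have h1 : 1 < x := by
    by_contra h1
    exact hxK ⟨le_of_lt hx, not_lt.1 h1⟩
  filter_upwards [Ioi_mem_nhds h1] with y hy using hc.far y (le_of_lt hy)

theorem exists_field_lower (hc : TimeChart ξ₀ ψ) {c : ℝ} (h : 0 < c) :
    ∃ δ > 0, ∀ x, c ≤ x → δ ≤ |ξ₀ x| := by
  obtain ⟨z, hz, hmin⟩ := (isCompact_Icc (a := c) (b := max c 1)).exists_isMinOn
    ⟨c, le_rfl, le_max_left _ _⟩ (f := fun x => |ξ₀ x|)
    ((hc.smooth.continuousOn.mono fun x hx => h.le.trans hx.1).abs)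
  refine ⟨|ξ₀ z|, abs_pos.2 (hc.neg z (h.trans_le hz.1)).ne, fun x hx => ?_⟩
  rcases le_total x (max c 1) with hle | hle
  · exact hmin ⟨hx, hle⟩
  · rw [hc.far x ((le_max_right _ _).trans hle), ← hc.far _ (le_max_right c 1)]
    exact hmin ⟨le_max_left _ _, le_rfl⟩

theorem tame (hc : TimeChart ξ₀ ψ) (T : ℝ) : UnifTame (Iio T) (fun _ : Unit => ψ) :=
  .of_hasDerivAt_comp isOpen_Iio isOpen_Ioi (hc.unifBdd_field (hc.pos T))
    (fun _ _ ht => hc.strictAnti ht) fun _ t _ => hc.deriv t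

theorem tame_invFun (hc : TimeChart ξ₀ ψ) {c : ℝ} (h : 0 < c) :
    UnifTame (Ioi c) (fun _ : Unit => Function.invFun ψ) := by
  obtain ⟨δ, hδ, hb⟩ := hc.exists_field_lower h
  exact .of_deriv isOpen_Ioi (fun _ x hx => hc.hasDerivAt_invFun (h.trans hx))
    ((hc.unifBdd_field h).inv isOpen_Ioi hδ fun _ x hx => hb x (le_of_lt hx))

theorem conj_eventuallyEq {x : ℝ} (hx : 0 < x) :
    conjHalfLine ψ Φ =ᶠ[𝓝 x] fun y => ψ (Φ (Function.invFun ψ y)) := by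
  filter_upwards [Ioi_mem_nhds hx] with y hy using if_pos hy

theorem hasDerivAt_conj (hc : TimeChart ξ₀ ψ) {d t : ℝ} (h : HasDerivAt Φ d t) :
    HasDerivAt (conjHalfLine ψ Φ) (ξ₀ (ψ (Φ t)) * (d * (ξ₀ (ψ t))⁻¹)) (ψ t) := by
  refine HasDerivAt.congr_of_eventuallyEq ?_ (conj_eventuallyEq (hc.pos t))
  have h1 := hc.hasDerivAt_invFun (hc.pos t)
  rw [← hc.invFun_apply t] at h
  have h2 := (hc.deriv (Φ (Function.invFun ψ (ψ t)))).comp (ψ t) (h.comp (ψ t) h1)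
  rw [hc.invFun_apply] at h2
  exact h2

theorem conj_eq_self (hc : TimeChart ξ₀ ψ) {T : ℝ} (hT : ∀ t ≥ T, Φ t = t) {x : ℝ}
    (hx : x ∈ Icc 0 (ψ T)) : conjHalfLine ψ Φ x = x := by
  rcases hx.1.eq_or_lt with rfl | h0
  · exact conjHalfLine_zero ψ Φ
  · obtain ⟨t, rfl⟩ := hc.exists_eq h0
    rw [hc.conj_apply, hT t (hc.strictAnti.le_iff_ge.1 hx.2)]

theorem conj_eventually_eq_self (hc : TimeChart ξ₀ ψ) (hT : ∃ T, ∀ t ≥ T, Φ t = t) :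
    ∀ᶠ x in 𝓝[≥] (0 : ℝ), conjHalfLine ψ Φ x = x := by
  obtain ⟨T, hT⟩ := hT
  filter_upwards [Icc_mem_nhdsGE (hc.pos T)] with x hx using hc.conj_eq_self hT hx

theorem conj_mem (hc : TimeChart ξ₀ ψ) (Φ : ℝ → ℝ) (x : ℝ) : conjHalfLine ψ Φ x ∈ Ici 0 := by
  unfold conjHalfLine
  split_ifs
  · exact (hc.pos _).le
  · exact le_refl (0 : ℝ)

theorem conj_conj (hc : TimeChart ξ₀ ψ) {Φ B : ℝ → ℝ} (h : ∀ t, B (Φ t) = t) {x : ℝ}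
    (hx : x ∈ Ici (0 : ℝ)) : conjHalfLine ψ B (conjHalfLine ψ Φ x) = x := by
  rcases (mem_Ici.1 hx).eq_or_lt with rfl | h0
  · rw [conjHalfLine_zero, conjHalfLine_zero]
  · obtain ⟨t, rfl⟩ := hc.exists_eq h0
    rw [hc.conj_apply, hc.conj_apply, h]

theorem exists_hasDerivWithinAt_conj (hc : TimeChart ξ₀ ψ)
    (hd : ∀ t, ∃ d > 0, HasDerivAt Φ d t) (hT : ∃ T, ∀ t ≥ T, Φ t = t) {x : ℝ}
    (hx : x ∈ Ici (0 : ℝ)) :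
    ∃ d : ℝ, 0 < d ∧ HasDerivWithinAt (conjHalfLine ψ Φ) d (Ici 0) x := by
  rcases (mem_Ici.1 hx).eq_or_lt with rfl | h0
  · exact ⟨1, one_pos, (hasDerivWithinAt_id _ _).congr_of_eventuallyEq
      (hc.conj_eventually_eq_self hT) (conjHalfLine_zero ψ Φ)⟩
  · obtain ⟨t, rfl⟩ := hc.exists_eq h0
    obtain ⟨d, hd, hΦ⟩ := hd t
    exact ⟨_, mul_pos_of_neg_of_neg (hc.field_neg _)
      (mul_neg_of_pos_of_neg hd (inv_neg''.2 (hc.field_neg t))),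
      (hc.hasDerivAt_conj hΦ).hasDerivWithinAt⟩

theorem crHalfLineDiffeo_conj (hc : TimeChart ξ₀ ψ) (hΦ : TameDiffeo Φ) :
    CrHalfLineDiffeo ⊤ (conjHalfLine ψ Φ) := by
  have hinv : InvOn (conjHalfLine ψ (Function.invFun Φ)) (conjHalfLine ψ Φ) (Ici 0) (Ici 0) :=
    ⟨fun _ hx => hc.conj_conj hΦ.invFun_apply hx, fun _ hx => hc.conj_conj hΦ.apply_invFun hx⟩
  have hbij : BijOn (conjHalfLine ψ Φ) (Ici 0) (Ici 0) :=
    hinv.bijOn (fun x _ => hc.conj_mem Φ x) fun x _ => hc.conj_mem _ x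
  have hid : ∃ T, ∀ t ≥ T, Function.invFun Φ t = t :=
    hΦ.ident.imp fun T hT t ht => hΦ.invFun_eq_self (hT t ht)
  refine ⟨⟨conjHalfLine_zero ψ Φ, hbij, fun x hx => ?_, fun y hy => ?_⟩, fun x hx => ?_⟩
  · exact hc.exists_hasDerivWithinAt_conj
      (fun t => ⟨_, hΦ.deriv_pos t, (hΦ.differentiable t).hasDerivAt⟩) hΦ.ident hx
  · obtain ⟨d, -, hd⟩ := hc.exists_hasDerivWithinAt_conj
      (fun t => ⟨_, inv_pos.2 (hΦ.deriv_pos _), hΦ.hasDerivAt_invFun t⟩) hid hy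
    have heq : EqOn (Function.invFunOn (conjHalfLine ψ Φ) (Ici 0))
        (conjHalfLine ψ (Function.invFun Φ)) (Ici 0) := fun y hy =>
      hbij.injOn (hbij.surjOn.mapsTo_invFunOn hy) (hc.conj_mem _ y)
        (by rw [hbij.surjOn.rightInvOn_invFunOn hy, hinv.2 hy])
    exact ⟨d, hd.congr heq (heq hy)⟩
  · rcases (mem_Ici.1 hx).eq_or_lt with rfl | h0
    · exact contDiffWithinAt_id.congr_of_eventuallyEq (hc.conj_eventually_eq_self hΦ.ident)
        (conjHalfLine_zero ψ Φ)
    · refine (ContDiffAt.congr_of_eventuallyEq ?_ (conj_eventuallyEq h0)).contDiffWithinAt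
      have h1 := ((hc.tame_invFun (half_pos h0)).smooth ()).contDiffAt
        (Ioi_mem_nhds (half_lt_self h0))
      have h2 := (hΦ.tame.smooth ()).contDiffAt (x := Function.invFun ψ x) univ_mem
      have h3 := ((hc.tame (Φ (Function.invFun ψ x) + 1)).smooth ()).contDiffAt
        (Iio_mem_nhds (lt_add_one _))
      exact h3.comp x (h2.comp x h1)

theorem derivWithin_conj (hc : TimeChart ξ₀ ψ) {t : ℝ} (h : DifferentiableAt ℝ Φ t) :
    derivWithin (conjHalfLine ψ Φ) (Ici 0) (ψ t) =
      ξ₀ (ψ (Φ t)) * (_root_.deriv Φ t * (ξ₀ (ψ t))⁻¹) :=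
  (hc.hasDerivAt_conj h.hasDerivAt).hasDerivWithinAt.derivWithin
    (uniqueDiffOn_Ici 0 _ (hc.pos t).le)

theorem conjField_apply (hc : TimeChart ξ₀ ψ) (hΦ : TameDiffeo Φ) (t : ℝ) :
    conjField ξ₀ ψ Φ (ψ t) = ξ₀ (ψ t) * (_root_.deriv Φ t)⁻¹ := by
  rw [conjField, hc.derivWithin_conj (hΦ.differentiable t), hc.conj_apply]
  have := (hc.field_neg (Φ t)).ne
  have := (hc.field_neg t).ne
  have := (hΦ.deriv_pos t).ne'
  field_simp

theorem conjField_zero (hc : TimeChart ξ₀ ψ) : conjField ξ₀ ψ Φ 0 = 0 := by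
  rw [conjField, conjHalfLine_zero, hc.zero, zero_div]

theorem conjFlow_apply (hc : TimeChart ξ₀ ψ) (s t : ℝ) :
    conjFlow ψ Φ s (ψ t) = ψ (Function.invFun Φ (Φ t + s)) := hc.conj_apply _ t

theorem isFlowOf_conjFlow (hc : TimeChart ξ₀ ψ) (hΦ : TameDiffeo Φ) :
    IsFlowOf (conjField ξ₀ ψ Φ) (conjFlow ψ Φ) := by
  intro x hx
  rcases (mem_Ici.1 hx).eq_or_lt with rfl | h0
  · have h : ∀ s, conjFlow ψ Φ s 0 = 0 := fun s => conjHalfLine_zero _ _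
    refine ⟨h 0, fun t => ⟨hc.conj_mem _ _, ?_⟩⟩
    simp only [h, hc.conjField_zero]
    exact hasDerivAt_const _ _
  · obtain ⟨t, rfl⟩ := hc.exists_eq h0
    refine ⟨by rw [hc.conjFlow_apply, add_zero, hΦ.invFun_apply], fun s =>
      ⟨hc.conj_mem _ _, ?_⟩⟩
    simp only [hc.conjFlow_apply, hc.conjField_apply hΦ]
    exact (hc.deriv _).comp s ((hΦ.hasDerivAt_invFun _).comp_const_add (Φ t) s)

end TimeChart

/-! ### Small periodic kicks -/

/-- `τ ↦ τ + w ∑_{p ≥ 0} γ (q τ + p)`. -/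
noncomputable def kick (γ : ℝ → ℝ) (q : ℕ) (w τ : ℝ) : ℝ := τ + w * shiftSum γ (q * τ)

/-- The defect `k⁻¹ (k τ + s) - (τ + s)` of the kick `k` from commuting with the translation by
`s`. -/
noncomputable def kickDefect (γ : ℝ → ℝ) (q : ℕ) (w s τ : ℝ) : ℝ :=
  Function.invFun (kick γ q w) (kick γ q w τ + s) - τ - s

section Kick

variable {γ : ℝ → ℝ} {q : ℕ} {w : ℝ}

theorem unifBdd_kickProfile (hγ : ∀ t : ℝ, t ∉ Icc (-(1 / 4) : ℝ) (1 / 4) → γ t = 0)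
    (hs : ContDiff ℝ ((⊤ : ℕ∞) : WithTop ℕ∞) γ) (q : ℕ) (ι : Type*) :
    UnifBdd univ (fun _ : ι => fun τ : ℝ => shiftSum γ (q * τ)) :=
  (unifBdd_shiftSum hγ hs).comp isOpen_univ isOpen_univ
    (.of_deriv isOpen_univ (f' := fun _ _ => (q : ℝ))
      (fun _ x _ => by simpa using (hasDerivAt_id x).const_mul (q : ℝ))
      (unifBdd_const (fun _ => (q : ℝ)) (C := q) (by simp)))
    (fun _ => mapsTo_univ _ _)

theorem exists_kick_threshold (hγ : ∀ t : ℝ, t ∉ Icc (-(1 / 4) : ℝ) (1 / 4) → γ t = 0)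
    (hs : ContDiff ℝ ((⊤ : ℕ∞) : WithTop ℕ∞) γ) (q : ℕ) :
    ∃ w₀ > 0, w₀ ≤ 1 ∧ ∀ w ∈ Icc 0 w₀, ∀ τ,
      -(1 / 2) ≤ w * deriv (fun τ : ℝ => shiftSum γ (q * τ)) τ := by
  obtain ⟨K, hK⟩ :=
    ((unifBdd_kickProfile hγ hs q Unit).tame.deriv isOpen_univ).exists_bound
  have hK0 : 0 ≤ K := (abs_nonneg _).trans (hK () 0 (mem_univ _))
  refine ⟨(2 * K + 1)⁻¹, by positivity, inv_le_one_of_one_le₀ (by linarith), fun w hw τ => ?_⟩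
  have h1 := (abs_le.1 (hK () τ (mem_univ _))).1
  have h2 : w * (2 * K + 1) ≤ 1 := by
    have := mul_le_mul_of_nonneg_right hw.2 (by linarith : 0 ≤ 2 * K + 1)
    rwa [inv_mul_cancel₀ (by linarith)] at this
  nlinarith [mul_le_mul_of_nonneg_left h1 hw.1, hw.1]

theorem hasDerivAt_kick (hγ : ∀ t : ℝ, t ∉ Icc (-(1 / 4) : ℝ) (1 / 4) → γ t = 0)
    (hs : ContDiff ℝ ((⊤ : ℕ∞) : WithTop ℕ∞) γ) (q : ℕ) (w τ : ℝ) :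
    HasDerivAt (kick γ q w) (1 + w * deriv (fun τ : ℝ => shiftSum γ (q * τ)) τ) τ :=
  (hasDerivAt_id τ).add
    (((unifBdd_kickProfile hγ hs q Unit).tame.hasDerivAt isOpen_univ () (mem_univ τ)).const_mul w)

theorem kick_add_of_le (hγ : ∀ t : ℝ, t ∉ Icc (-(1 / 4) : ℝ) (1 / 4) → γ t = 0) (hq : 0 < q)
    {m : ℕ} (hm : m ≤ q) {τ : ℝ} (hτ : 1 ≤ |τ|) :
    kick γ q w (τ + m / q) = kick γ q w τ + m / q := by
  have hq' : (1 : ℝ) ≤ q := by exact_mod_cast hq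
  have hm' : (m : ℝ) ≤ q := by exact_mod_cast hm
  have hmul : (q : ℝ) * (τ + m / q) = q * τ + m := by field_simp
  rw [kick, kick, hmul]
  rcases le_abs.1 hτ with h | h
  · rw [shiftSum_of_one_le hγ (u := q * τ + m) (by nlinarith [m.cast_nonneg (α := ℝ)]),
      shiftSum_of_one_le hγ (by nlinarith)]
    ring
  · rw [shiftSum_add_nat hγ m (by nlinarith)]
    ring

/-- The kick is an increasing diffeomorphism of the line. -/
theorem kick_props (hγ : ∀ t : ℝ, t ∉ Icc (-(1 / 4) : ℝ) (1 / 4) → γ t = 0)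
    (hs : ContDiff ℝ ((⊤ : ℕ∞) : WithTop ℕ∞) γ)
    (hw : ∀ τ, -(1 / 2) ≤ w * deriv (fun τ : ℝ => shiftSum γ (q * τ)) τ) :
    (∀ τ, 1 / 2 ≤ deriv (kick γ q w) τ) ∧ StrictMono (kick γ q w) ∧
      ∀ x, kick γ q w (Function.invFun (kick γ q w) x) = x := by
  have hd : ∀ τ, 1 / 2 ≤ deriv (kick γ q w) τ := fun τ => by
    rw [(hasDerivAt_kick hγ hs q w τ).deriv]
    linarith [hw τ]
  exact ⟨hd, strictMono_of_le_deriv one_half_pos hd, Function.rightInverse_invFun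
    (surjective_of_le_deriv (fun τ => (hasDerivAt_kick hγ hs q w τ).differentiableAt)
      one_half_pos hd)⟩

theorem kick_add_defect (hinv : ∀ x, kick γ q w (Function.invFun (kick γ q w) x) = x)
    (s τ : ℝ) : kick γ q w (τ + s + kickDefect γ q w s τ) = kick γ q w τ + s := by
  rw [kickDefect, show ∀ a, τ + s + (a - τ - s) = a from fun a => by ring, hinv]

theorem kickDefect_eq_zero (hγ : ∀ t : ℝ, t ∉ Icc (-(1 / 4) : ℝ) (1 / 4) → γ t = 0)
    (hmono : StrictMono (kick γ q w)) (hq : 0 < q) {m : ℕ} (hm : m ≤ q) {τ : ℝ}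
    (hτ : 1 ≤ |τ|) : kickDefect γ q w (m / q) τ = 0 := by
  rw [kickDefect, ← kick_add_of_le hγ hq hm hτ, Function.leftInverse_invFun hmono.injective]
  ring

theorem add_kickDefect_mem (hγ : ∀ t : ℝ, t ∉ Icc (-(1 / 4) : ℝ) (1 / 4) → γ t = 0)
    (hmono : StrictMono (kick γ q w))
    (hinv : ∀ x, kick γ q w (Function.invFun (kick γ q w) x) = x) (hq : 0 < q) {m : ℕ}
    (hm : m ≤ q) {τ : ℝ} (hτ : τ ∈ Icc (-1 : ℝ) 1) :
    τ + m / q + kickDefect γ q w (m / q) τ ∈ Icc (-1 : ℝ) 2 := by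
  have hs1 : (m : ℝ) / q ≤ 1 := div_le_one_of_le₀ (by exact_mod_cast hm) (by positivity)
  have hs0 : (0 : ℝ) ≤ m / q := by positivity
  constructor <;> rw [← hmono.le_iff_le, kick_add_defect hinv]
  · calc kick γ q w (-1) ≤ kick γ q w (-1 + m / q) := hmono.monotone (by linarith)
      _ = kick γ q w (-1) + m / q := kick_add_of_le hγ hq hm (by simp)
      _ ≤ _ := by gcongr; exact hmono.monotone hτ.1
  · calc kick γ q w τ + m / q ≤ kick γ q w 1 + m / q := by gcongr; exact hmono.monotone hτ.2
      _ = kick γ q w (1 + m / q) := (kick_add_of_le hγ hq hm (by simp)).symm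
      _ ≤ kick γ q w 2 := hmono.monotone (by linarith)

/-- The commutation defect of a kick of size `w` with translations is `O(w)` together with all
its derivatives. -/
theorem exists_kickDefect_bound (hγ : ∀ t : ℝ, t ∉ Icc (-(1 / 4) : ℝ) (1 / 4) → γ t = 0)
    (hs : ContDiff ℝ ((⊤ : ℕ∞) : WithTop ℕ∞) γ) (q : ℕ) {w₀ : ℝ}
    (hw₀ : ∀ w ∈ Icc 0 w₀, ∀ τ, -(1 / 2) ≤ w * deriv (fun τ : ℝ => shiftSum γ (q * τ)) τ)
    (M : ℕ) :
    ∃ C, 0 ≤ C ∧ ∀ w ∈ Icc 0 w₀, ∀ s,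
      ContDiff ℝ ((⊤ : ℕ∞) : WithTop ℕ∞) (kickDefect γ q w s) ∧
      ∀ i ≤ M, ∀ τ, |iteratedDeriv i (kickDefect γ q w s) τ| ≤ w * C := by
  let ι := Icc 0 w₀ × ℝ
  have hS := unifBdd_kickProfile hγ hs q ι
  have hw0 : ∀ i : ι, |(i.1 : ℝ)| ≤ w₀ := fun i => by
    rw [abs_of_nonneg i.1.2.1]; exact i.1.2.2
  have hk : UnifTame univ (fun i : ι => kick γ q i.1) :=
    ((unifTame_id_add_const (fun _ => 0) isOpen_univ).add isOpen_univ
      (hS.const_mul isOpen_univ (fun i : ι => (i.1 : ℝ)) hw0).tame).congr isOpen_univ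
      fun i x _ => by simp [kick]
  have hp := fun i : ι => kick_props (q := q) hγ hs (hw₀ i.1 i.1.2)
  have hinv : UnifTame univ (fun i : ι => Function.invFun (kick γ q i.1)) :=
    hk.rightInverse one_half_pos (fun i => (hp i).1) fun i => (hp i).2.2
  have hA : UnifTame univ
      (fun i : ι => Function.invFun (kick γ q i.1) ∘ fun τ => kick γ q i.1 τ + i.2) :=
    hinv.comp isOpen_univ isOpen_univ
      (((unifTame_id_add_const (fun i : ι => i.2) isOpen_univ).comp isOpen_univ isOpen_univ hk
        fun _ => mapsTo_univ _ _).congr isOpen_univ fun _ _ _ => rfl) fun _ => mapsTo_univ _ _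
  have hR := hS.sub isOpen_univ (hS.comp isOpen_univ isOpen_univ hA fun _ => mapsTo_univ _ _)
  obtain ⟨C, hC1, hC⟩ := UnifDerivBdd.exists_common (m := M) fun l _ => hR.bdd l
  refine ⟨C, zero_le_one.trans hC1, fun w hw s => ?_⟩
  let i : ι := (⟨w, hw⟩, s)
  have heq : kickDefect γ q w s = fun τ => w * (shiftSum γ (q * τ) -
      ((fun τ : ℝ => shiftSum γ (q * τ)) ∘
        (Function.invFun (kick γ q w) ∘ fun τ => kick γ q w τ + s)) τ) := by
    funext τ
    have h := kick_add_defect (hp i).2.2 s τ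
    have h' : τ + s + kickDefect γ q w s τ =
      Function.invFun (kick γ q w) (kick γ q w τ + s) := by rw [kickDefect]; ring
    change kick γ q w (τ + s + kickDefect γ q w s τ) = kick γ q w τ + s at h
    rw [h'] at h
    simp only [Function.comp]
    generalize Function.invFun (kick γ q w) (kick γ q w τ + s) = a at *
    rw [kick, kick] at h
    linarith
  rw [heq]
  refine ⟨contDiff_const.mul (contDiffOn_univ.1 (hR.smooth i)), fun l hl τ => ?_⟩
  rw [iteratedDeriv_const_mul_field, abs_mul, abs_of_nonneg hw.1]
  exact mul_le_mul_of_nonneg_left (hC l hl i τ (mem_univ _)) hw.1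

end Kick

/-! ### Perturbing a conjugation by a kick -/

/-- The kick `t ↦ t + ∑_{p ≥ 0} w γ(q (t + p / q - j))` based at the integer `j`. -/
noncomputable def kickAt (γ : ℝ → ℝ) (q : ℕ) (w : ℝ) (j : ℤ) (t : ℝ) : ℝ :=
  t + ∑' p : ℕ, w * γ ((q : ℝ) * (t + (p : ℝ) / (q : ℝ) - (j : ℝ)))

theorem kickAt_eq (γ : ℝ → ℝ) {q : ℕ} (hq : 0 < q) (w : ℝ) (j : ℤ) (t : ℝ) :
    kickAt γ q w j t = t + w * shiftSum γ (q * (t - j)) := by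
  have hq' : (q : ℝ) ≠ 0 := by exact_mod_cast hq.ne'
  rw [kickAt, tsum_mul_left, shiftSum]
  congr 3
  funext p
  congr 1
  field_simp
  ring

theorem kickAt_eq_kick (γ : ℝ → ℝ) {q : ℕ} (hq : 0 < q) (w : ℝ) (j : ℤ) (t : ℝ) :
    kickAt γ q w j t = j + kick γ q w (t - j) := by
  rw [kickAt_eq γ hq, kick]
  ring

section Perturbation

variable {γ : ℝ → ℝ} {q : ℕ} {w w₀ : ℝ} {j : ℤ} {Φ : ℝ → ℝ}

theorem unifBdd_kickPerturbation (hγ : ∀ t : ℝ, t ∉ Icc (-(1 / 4) : ℝ) (1 / 4) → γ t = 0)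
    (hs : ContDiff ℝ ((⊤ : ℕ∞) : WithTop ℕ∞) γ) (q : ℕ) (hΦ : TameDiffeo Φ) {ι : Type*}
    (j : ι → ℤ) : UnifBdd univ (fun i t => shiftSum γ (q * (Φ t - j i))) :=
  (unifBdd_kickProfile hγ hs q ι).comp isOpen_univ isOpen_univ
    ((unifTame_id_add_const (fun i => -(j i : ℝ)) isOpen_univ).comp isOpen_univ isOpen_univ
      (hΦ.tame.reindex fun _ => ()) fun _ => mapsTo_univ _ _) fun _ => mapsTo_univ _ _

theorem hasDerivAt_kickAt_comp (hγ : ∀ t : ℝ, t ∉ Icc (-(1 / 4) : ℝ) (1 / 4) → γ t = 0)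
    (hs : ContDiff ℝ ((⊤ : ℕ∞) : WithTop ℕ∞) γ) (hq : 0 < q) (hΦ : TameDiffeo Φ) (w : ℝ) (j : ℤ)
    (t : ℝ) :
    HasDerivAt (kickAt γ q w j ∘ Φ)
      ((1 + w * deriv (fun τ : ℝ => shiftSum γ (q * τ)) (Φ t - j)) * deriv Φ t) t := by
  have h : kickAt γ q w j ∘ Φ = fun t => (j : ℝ) + kick γ q w (Φ t - j) :=
    funext fun t => kickAt_eq_kick γ hq w j (Φ t)
  rw [h]
  exact ((hasDerivAt_kick hγ hs q w (Φ t - j)).comp t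
    ((hΦ.differentiable t).hasDerivAt.sub_const _)).const_add _

theorem kickAt_eq_self (hγ : ∀ t : ℝ, t ∉ Icc (-(1 / 4) : ℝ) (1 / 4) → γ t = 0) (hq : 0 < q)
    {t : ℝ} (ht : j + 1 ≤ t) : kickAt γ q w j t = t := by
  have hq' : (1 : ℝ) ≤ q := by exact_mod_cast hq
  rw [kickAt_eq γ hq, shiftSum_of_one_le hγ (by nlinarith), mul_zero, add_zero]

theorem TameDiffeo.exists_le_deriv_kickAt_comp
    (hγ : ∀ t : ℝ, t ∉ Icc (-(1 / 4) : ℝ) (1 / 4) → γ t = 0)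
    (hs : ContDiff ℝ ((⊤ : ℕ∞) : WithTop ℕ∞) γ) (hq : 0 < q) (hΦ : TameDiffeo Φ) :
    ∃ c > 0, ∀ w : ℝ, (∀ τ, -(1 / 2) ≤ w * deriv (fun τ : ℝ => shiftSum γ (q * τ)) τ) →
      ∀ (j : ℤ) (t : ℝ), c ≤ deriv (kickAt γ q w j ∘ Φ) t := by
  obtain ⟨c, hc, h⟩ := hΦ.lower
  refine ⟨c / 2, half_pos hc, fun w hw j t => ?_⟩
  rw [(hasDerivAt_kickAt_comp hγ hs hq hΦ w j t).deriv]
  nlinarith [hw (Φ t - j), h t]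

theorem unifTame_kickAt_comp (hγ : ∀ t : ℝ, t ∉ Icc (-(1 / 4) : ℝ) (1 / 4) → γ t = 0)
    (hs : ContDiff ℝ ((⊤ : ℕ∞) : WithTop ℕ∞) γ) (hq : 0 < q) (hΦ : TameDiffeo Φ) {ι : Type*}
    (w : ι → ℝ) {C : ℝ} (hw : ∀ i, |w i| ≤ C) (j : ι → ℤ) :
    UnifTame univ (fun i => kickAt γ q (w i) (j i) ∘ Φ) :=
  ((hΦ.tame.reindex fun _ => ()).add isOpen_univ
    ((unifBdd_kickPerturbation hγ hs q hΦ j).const_mul isOpen_univ w hw).tame).congr isOpen_univ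
    fun _ _ _ => kickAt_eq γ hq _ _ _

theorem TameDiffeo.kickAt_comp (hγ : ∀ t : ℝ, t ∉ Icc (-(1 / 4) : ℝ) (1 / 4) → γ t = 0)
    (hs : ContDiff ℝ ((⊤ : ℕ∞) : WithTop ℕ∞) γ) (hq : 0 < q) (hΦ : TameDiffeo Φ)
    (hw : ∀ τ, -(1 / 2) ≤ w * deriv (fun τ : ℝ => shiftSum γ (q * τ)) τ) (j : ℤ) :
    TameDiffeo (kickAt γ q w j ∘ Φ) where
  tame := unifTame_kickAt_comp hγ hs hq hΦ (fun _ => w) (fun _ => le_rfl) fun _ => j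
  lower := (hΦ.exists_le_deriv_kickAt_comp hγ hs hq).imp fun _ h => ⟨h.1, h.2 w hw j⟩
  ident := by
    obtain ⟨T, hT⟩ := hΦ.ident
    refine ⟨max T (j + 1), fun t ht => ?_⟩
    rw [Function.comp_apply, hT t ((le_max_left _ _).trans ht),
      kickAt_eq_self hγ hq ((le_max_right _ _).trans ht)]

theorem exists_kickAt_comp_sub_bound (hγ : ∀ t : ℝ, t ∉ Icc (-(1 / 4) : ℝ) (1 / 4) → γ t = 0)
    (hs : ContDiff ℝ ((⊤ : ℕ∞) : WithTop ℕ∞) γ) (hq : 0 < q) (hΦ : TameDiffeo Φ) (M : ℕ) :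
    ∃ C, ∀ w, 0 ≤ w → ∀ j : ℤ, ∀ i ≤ M, ∀ t,
      |iteratedDeriv i (fun t => (kickAt γ q w j ∘ Φ) t - Φ t) t| ≤ w * C := by
  obtain ⟨C, -, hC⟩ := UnifDerivBdd.exists_common (m := M)
    fun l _ => (unifBdd_kickPerturbation hγ hs q hΦ (fun j : ℤ => j)).bdd l
  refine ⟨C, fun w hw j i hi t => ?_⟩
  have h : (fun t => (kickAt γ q w j ∘ Φ) t - Φ t) =
      fun t => w * shiftSum γ (q * (Φ t - j)) :=
    funext fun t => by rw [Function.comp_apply, kickAt_eq γ hq, add_sub_cancel_left]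
  rw [h, iteratedDeriv_const_mul_field, abs_mul, abs_of_nonneg hw]
  exact mul_le_mul_of_nonneg_left (hC i hi j t (mem_univ t)) hw

/-! ### The effect of a kick on the field -/

theorem TimeChart.conjField_eventually_eq {ξ₀ ψ : ℝ → ℝ} (hc : TimeChart ξ₀ ψ)
    (hΦ : TameDiffeo Φ) : ∀ᶠ x in 𝓝[≥] (0 : ℝ), conjField ξ₀ ψ Φ x = ξ₀ x := by
  obtain ⟨T, hT⟩ := hΦ.ident
  filter_upwards [Ico_mem_nhdsGE (hc.pos T)] with x hx
  rcases hx.1.eq_or_lt with rfl | h0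
  · rw [hc.conjField_zero, hc.zero]
  · obtain ⟨t, rfl⟩ := hc.exists_eq h0
    have h1 : Φ =ᶠ[𝓝 t] id := by
      filter_upwards [Ioi_mem_nhds (hc.strictAnti.lt_iff_gt.1 hx.2)] with s hs
      exact hT s (le_of_lt hs)
    rw [hc.conjField_apply hΦ, h1.deriv_eq, deriv_id, inv_one, mul_one]

theorem TimeChart.exists_field_bound {ξ₀ ψ : ℝ → ℝ} (hc : TimeChart ξ₀ ψ) :
    ∃ K, ∀ x, 0 < x → |ξ₀ x| ≤ K ∧ |_root_.deriv ξ₀ x| ≤ K := by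
  have h1 : ContinuousOn (fun x => derivWithin ξ₀ (Ici 0) x) (Ici 0) :=
    hc.smooth.continuousOn_derivWithin (uniqueDiffOn_Ici 0) (by norm_cast)
  obtain ⟨K, hK⟩ := (isCompact_Icc (a := (0 : ℝ)) (b := 1)).exists_bound_of_continuousOn
    (f := fun x => |ξ₀ x| + |derivWithin ξ₀ (Ici 0) x|)
    ((hc.smooth.continuousOn.abs.add h1.abs).mono Icc_subset_Ici_self)
  refine ⟨max K 1, fun x hx => ?_⟩
  rcases le_or_gt x 1 with hx1 | hx1
  · have h2 := (le_abs_self _).trans (hK x ⟨hx.le, hx1⟩)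
    rw [derivWithin_of_mem_nhds (Ici_mem_nhds hx)] at h2
    have h3 := abs_nonneg (ξ₀ x)
    have h4 := abs_nonneg (_root_.deriv ξ₀ x)
    exact ⟨le_max_of_le_left (by linarith), le_max_of_le_left (by linarith)⟩
  · have h2 : ξ₀ =ᶠ[𝓝 x] fun _ => -1 := by
      filter_upwards [Ioi_mem_nhds hx1] with y hy using hc.far y (le_of_lt hy)
    rw [h2.deriv_eq, h2.self_of_nhds]
    simp

theorem TimeChart.exists_conjField_sub_bound {ξ₀ ψ : ℝ → ℝ} (hc : TimeChart ξ₀ ψ)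
    (hγ : ∀ t : ℝ, t ∉ Icc (-(1 / 4) : ℝ) (1 / 4) → γ t = 0)
    (hs : ContDiff ℝ ((⊤ : ℕ∞) : WithTop ℕ∞) γ) (hq : 0 < q) (hΦ : TameDiffeo Φ)
    (hw₀ : ∀ w ∈ Icc 0 w₀, ∀ τ, -(1 / 2) ≤ w * _root_.deriv (fun τ : ℝ => shiftSum γ (q * τ)) τ) :
    ∃ C, ∀ w ∈ Icc 0 w₀, ∀ j : ℤ, ∀ i ≤ 1, ∀ x ∈ Ici (0 : ℝ),
      |iteratedDerivWithin i
        (fun x => conjField ξ₀ ψ (kickAt γ q w j ∘ Φ) x - conjField ξ₀ ψ Φ x) (Ici 0) x| ≤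
        w * C := by
  let ι := Icc 0 w₀ × ℤ
  let R : ι → ℝ → ℝ := fun i t => shiftSum γ (q * (Φ t - i.2))
  let Φ' : ι → ℝ → ℝ := fun i => kickAt γ q i.1 i.2 ∘ Φ
  have hR : UnifBdd univ R := unifBdd_kickPerturbation hγ hs q hΦ _
  have hΦ' : UnifTame univ Φ' := unifTame_kickAt_comp hγ hs hq hΦ (fun i : ι => (i.1 : ℝ))
    (fun i => (abs_of_nonneg i.1.2.1).le.trans i.1.2.2) _
  obtain ⟨c', hc', hl'⟩ := hΦ.exists_le_deriv_kickAt_comp hγ hs hq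
  obtain ⟨c, hc0, hl⟩ := hΦ.lower
  let Q : ι → ℝ → ℝ := fun i t =>
    _root_.deriv (R i) t * ((_root_.deriv (Φ' i) t)⁻¹ * (_root_.deriv Φ t)⁻¹)
  have hQ : UnifBdd univ Q := (hR.tame.deriv isOpen_univ).mul isOpen_univ
    (((hΦ'.deriv isOpen_univ).inv isOpen_univ hc' fun i t _ =>
      (hl' i.1 (hw₀ _ i.1.2) i.2 t).trans (le_abs_self _)).mul isOpen_univ
      (((hΦ.tame.reindex fun _ : ι => ()).deriv isOpen_univ).inv isOpen_univ hc0
        fun i t _ => (hl t).trans (le_abs_self _)))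
  obtain ⟨A, hA⟩ := hQ.exists_bound
  obtain ⟨B, hB⟩ := (hQ.tame.deriv isOpen_univ).exists_bound
  obtain ⟨K, hK⟩ := hc.exists_field_bound
  have hK0 : 0 ≤ K := (abs_nonneg _).trans (hK 1 one_pos).1
  refine ⟨K * |A| + |B|, fun w hw j i hi x hx => ?_⟩
  let p : ι := (⟨w, hw⟩, j)
  have hΦ'p : TameDiffeo (Φ' p) := hΦ.kickAt_comp hγ hs hq (hw₀ w hw) j
  have hA0 : ∀ t, |Q p t| ≤ |A| := fun t => (hA p t (mem_univ t)).trans (le_abs_self A)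
  have hB0 : ∀ t, |_root_.deriv (Q p) t| ≤ |B| := fun t =>
    (hB p t (mem_univ t)).trans (le_abs_self B)
  have hform : ∀ x, 0 < x → conjField ξ₀ ψ (Φ' p) x - conjField ξ₀ ψ Φ x =
      -w * (ξ₀ x * Q p (Function.invFun ψ x)) := by
    intro x hx
    obtain ⟨t, rfl⟩ := hc.exists_eq hx
    rw [hc.conjField_apply hΦ'p, hc.conjField_apply hΦ, hc.invFun_apply]
    have h1 := (hΦ'p.deriv_pos t).ne'
    have h2 := (hΦ.deriv_pos t).ne'
    have h3 : _root_.deriv (Φ' p) t = _root_.deriv Φ t + w * _root_.deriv (R p) t := by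
      have h4 : Φ' p = fun t => Φ t + w * R p t := funext fun t => kickAt_eq γ hq _ _ _
      rw [h4]
      exact ((hΦ.differentiable t).hasDerivAt.add
        ((hR.tame.hasDerivAt isOpen_univ p (mem_univ t)).const_mul w)).deriv
    simp only [Q]
    field_simp
    rw [h3]
    ring
  rcases (mem_Ici.1 hx).eq_or_lt with rfl | h0
  · have h1 : (fun x => conjField ξ₀ ψ (Φ' p) x - conjField ξ₀ ψ Φ x) =ᶠ[𝓝[≥] 0] fun _ => 0 := by
      filter_upwards [hc.conjField_eventually_eq hΦ'p, hc.conjField_eventually_eq hΦ] with x h2 h3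
      rw [h2, h3, sub_self]
    have h2 := h1.iteratedDerivWithin_eq (n := i) (h1.self_of_nhdsWithin self_mem_Ici)
    rw [show (kickAt γ q w j ∘ Φ) = Φ' p from rfl, h2]
    simp only [iteratedDerivWithin_const, ite_self, abs_zero]
    have := hw.1
    positivity
  · have hloc : (fun x => conjField ξ₀ ψ (Φ' p) x - conjField ξ₀ ψ Φ x) =ᶠ[𝓝 x]
        fun x => -w * (ξ₀ x * Q p (Function.invFun ψ x)) := by
      filter_upwards [Ioi_mem_nhds h0] with y hy using hform y hy
    rcases Nat.le_one_iff_eq_zero_or_eq_one.1 hi with rfl | rfl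
    · rw [iteratedDerivWithin_zero, show (kickAt γ q w j ∘ Φ) = Φ' p from rfl, hform x h0, abs_mul,
        abs_neg, abs_of_nonneg hw.1, abs_mul]
      gcongr
      · exact hw.1
      · have := mul_le_mul (hK x h0).1 (hA0 (Function.invFun ψ x)) (abs_nonneg _) hK0
        linarith [abs_nonneg B]
    · rw [iteratedDerivWithin_one, derivWithin_of_mem_nhds (Ici_mem_nhds h0),
        show (kickAt γ q w j ∘ Φ) = Φ' p from rfl, hloc.deriv_eq]
      have hξ : HasDerivAt ξ₀ (_root_.deriv ξ₀ x) x :=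
        ((hc.smooth_Ioi.contDiffAt (Ioi_mem_nhds h0)).differentiableAt (by simp)).hasDerivAt
      have hd := (hξ.mul ((hQ.tame.hasDerivAt isOpen_univ p (mem_univ _)).comp x
        (hc.hasDerivAt_invFun h0))).const_mul (-w)
      have hne := (hc.neg x h0).ne
      rw [show _root_.deriv (fun x => -w * (ξ₀ x * Q p (Function.invFun ψ x))) x = _ from hd.deriv,
        abs_mul, abs_neg, abs_of_nonneg hw.1, mul_comm (_root_.deriv (Q p) _), Function.comp_apply,
        mul_inv_cancel_left₀ hne]
      gcongr
      · exact hw.1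
      · refine (abs_add_le _ _).trans (add_le_add ?_ (hB0 _))
        rw [abs_mul]
        exact mul_le_mul (hK x h0).2 (hA0 _) (abs_nonneg _) hK0

end Perturbation

/-! ### The effect of a kick on the flow at the resonant times -/

namespace TimeChart

variable {γ ξ₀ ψ Φ : ℝ → ℝ} {q : ℕ} {w : ℝ}

theorem conjFlow_kickAt_sub (hc : TimeChart ξ₀ ψ)
    (hγ : ∀ t : ℝ, t ∉ Icc (-(1 / 4) : ℝ) (1 / 4) → γ t = 0)
    (hs : ContDiff ℝ ((⊤ : ℕ∞) : WithTop ℕ∞) γ) (hq : 0 < q) (hΦ : TameDiffeo Φ)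
    (hw : ∀ τ, -(1 / 2) ≤ w * _root_.deriv (fun τ : ℝ => shiftSum γ (q * τ)) τ)
    {m : ℕ} (hm : m ≤ q) {T : ℝ} (hT : ∀ t ≥ T, Φ t = t) {j : ℤ} (hj : T ≤ j - 1) {v : ℝ}
    (hv : 0 < v) (haff : ∀ τ ∈ Icc (-1 : ℝ) 2, ψ (j + τ) = ψ j - v * τ) {x : ℝ}
    (hx : x ∈ Ici (0 : ℝ)) :
    conjFlow ψ (kickAt γ q w j ∘ Φ) (m / q) x - conjFlow ψ Φ (m / q) x =
      -v * kickDefect γ q w (m / q) ((ψ j - x) / v) := by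
  obtain ⟨-, hmono, hinv⟩ := kick_props hγ hs hw
  have hΦ' := hΦ.kickAt_comp hγ hs hq hw j
  have hs0 : (0 : ℝ) ≤ m / q := by positivity
  have hs1 : (m : ℝ) / q ≤ 1 := div_le_one_of_le₀ (by exact_mod_cast hm) (by positivity)
  have hplus : ψ (j + 1) = ψ j - v := by rw [haff 1 (by norm_num), mul_one]
  have hminus : ψ (j - 1) = ψ j + v := by
    rw [sub_eq_add_neg, haff (-1) (by norm_num)]
    ring
  rcases (mem_Ici.1 hx).eq_or_lt with rfl | h0
  · have h1 : 1 ≤ |(ψ j - 0) / v| := by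
      rw [sub_zero, abs_of_pos (div_pos (hc.pos _) hv), one_le_div hv]
      linarith [hc.pos (j + 1)]
    rw [kickDefect_eq_zero hγ hmono hq hm h1, conjFlow, conjFlow, conjHalfLine_zero,
      conjHalfLine_zero]
    ring
  obtain ⟨t, rfl⟩ := hc.exists_eq h0
  set s : ℝ := m / q with hs_def
  set E := kickDefect γ q w s (Φ t - j) with hE
  have hflow : Function.invFun (kickAt γ q w j ∘ Φ) ((kickAt γ q w j ∘ Φ) t + s) =
      Function.invFun Φ (Φ t + s + E) := by
    rw [← hΦ'.invFun_apply (Function.invFun Φ (Φ t + s + E))]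
    congr 1
    rw [Function.comp_apply, Function.comp_apply, hΦ.apply_invFun, kickAt_eq_kick γ hq,
      kickAt_eq_kick γ hq, show Φ t + s + E - j = Φ t - j + s + E by ring,
      hE, kick_add_defect hinv]
    ring
  rw [hc.conjFlow_apply, hc.conjFlow_apply, hflow]
  rcases le_or_gt 1 |Φ t - j| with hfar | hnear
  · have h1 : 1 ≤ |(ψ j - ψ t) / v| := by
      rw [abs_div, abs_of_pos hv, one_le_div hv]
      rcases le_abs.1 hfar with h | h
      · have h2 : Φ (j + 1) ≤ Φ t := by
          rw [hT _ (by linarith)]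
          linarith
        have h3 := hc.strictAnti.antitone (hΦ.strictMono.le_iff_le.1 h2)
        exact le_abs.2 (Or.inl (by linarith))
      · have h2 : Φ t ≤ Φ (j - 1) := by
          rw [hT _ hj]
          linarith
        have h3 := hc.strictAnti.antitone (hΦ.strictMono.le_iff_le.1 h2)
        exact le_abs.2 (Or.inr (by linarith))
    rw [kickDefect_eq_zero hγ hmono hq hm h1, hE, kickDefect_eq_zero hγ hmono hq hm hfar]
    simp
  · obtain ⟨h1, h2⟩ := abs_lt.1 hnear
    have ht : Φ t = t := by
      refine hT t (hj.trans (hΦ.strictMono.le_iff_le.1 ?_))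
      rw [hT _ hj]
      linarith
    rw [ht] at h1 h2 hE
    obtain ⟨h3, h4⟩ := add_kickDefect_mem hγ hmono hinv hq hm (τ := t - j) ⟨h1.le, h2.le⟩
    rw [← hs_def, ← hE] at h3 h4
    have e1 : ψ t = ψ j - v * (t - j) := by
      rw [← haff _ ⟨h1.le, by linarith⟩, add_sub_cancel]
    have e2 : ψ (t + s) = ψ j - v * (t - j + s) := by
      rw [← haff _ ⟨by linarith, by linarith⟩]
      congr 1
      ring
    have e3 : ψ (t + s + E) = ψ j - v * (t - j + s + E) := by
      rw [← haff _ ⟨h3, h4⟩]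
      congr 1
      ring
    rw [ht, hΦ.invFun_eq_self (hT (t + s + E) (by linarith)),
      hΦ.invFun_eq_self (hT (t + s) (by linarith)), e3, e2, e1,
      show (ψ j - (ψ j - v * (t - j))) / v = t - j by field_simp; ring, ← hE]
    ring

theorem exists_conjFlow_sub_bound (hc : TimeChart ξ₀ ψ)
    (hγ : ∀ t : ℝ, t ∉ Icc (-(1 / 4) : ℝ) (1 / 4) → γ t = 0)
    (hs : ContDiff ℝ ((⊤ : ℕ∞) : WithTop ℕ∞) γ) (hq : 0 < q) (hΦ : TameDiffeo Φ) {w₀ : ℝ}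
    (hw₀ : ∀ w ∈ Icc 0 w₀, ∀ τ, -(1 / 2) ≤ w * _root_.deriv (fun τ : ℝ => shiftSum γ (q * τ)) τ)
    {T : ℝ} (hT : ∀ t ≥ T, Φ t = t) (M : ℕ) :
    ∃ C, ∀ w ∈ Icc 0 w₀, ∀ j : ℤ, T ≤ j - 1 → ∀ v, 0 < v → v ≤ 1 →
      (∀ τ ∈ Icc (-1 : ℝ) 2, ψ (j + τ) = ψ j - v * τ) →
      ∀ m ≤ q, ∀ i ≤ M, ∀ x ∈ Ici (0 : ℝ),
      |iteratedDerivWithin i (fun x =>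
        conjFlow ψ (kickAt γ q w j ∘ Φ) (m / q) x - conjFlow ψ Φ (m / q) x) (Ici 0) x| ≤
        v⁻¹ ^ M * w * C := by
  obtain ⟨C, hC0, hC⟩ := exists_kickDefect_bound hγ hs q hw₀ M
  refine ⟨C, fun w hw j hj v hv hv1 haff m hm i hi x hx => ?_⟩
  obtain ⟨hsm, hb⟩ := hC w hw (m / q)
  have hform : EqOn (fun x =>
      conjFlow ψ (kickAt γ q w j ∘ Φ) (m / q) x - conjFlow ψ Φ (m / q) x)
      (fun x => -v * (fun u => kickDefect γ q w (m / q) (v⁻¹ * u)) (ψ j - x)) (Ici 0) := by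
    intro x hx
    simpa only [div_eq_inv_mul (ψ j - x)] using
      hc.conjFlow_kickAt_sub hγ hs hq hΦ (hw₀ w hw) hm hT hj hv haff hx
  have hsm' : ContDiff ℝ i (fun x =>
      -v * (fun u => kickDefect γ q w (m / q) (v⁻¹ * u)) (ψ j - x)) :=
    contDiff_const.mul ((hsm.of_le (by exact_mod_cast le_top)).comp
      (contDiff_const.mul (contDiff_const.sub contDiff_id)))
  rw [iteratedDerivWithin_congr hform hx,
    iteratedDerivWithin_eq_iteratedDeriv (uniqueDiffOn_Ici 0) hsm'.contDiffAt hx,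
    iteratedDeriv_const_mul_field,
    iteratedDeriv_comp_const_sub i fun u => kickDefect γ q w (m / q) (v⁻¹ * u),
    iteratedDeriv_comp_const_mul (hsm.of_le (by exact_mod_cast le_top))]
  have h1 : 1 ≤ v⁻¹ := (one_le_inv₀ hv).2 hv1
  simp only [smul_eq_mul]
  rw [abs_mul, abs_mul, abs_mul, abs_neg, abs_pow, abs_neg, abs_one, one_pow, one_mul,
    abs_of_pos hv, abs_of_pos (pow_pos (inv_pos.2 hv) i)]
  calc v * (v⁻¹ ^ i * |iteratedDeriv i (kickDefect γ q w (m / q)) (v⁻¹ * (ψ j - x))|)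
      ≤ 1 * (v⁻¹ ^ M * (w * C)) := by
        gcongr
        exact hb i hi _
    _ = v⁻¹ ^ M * w * C := by ring

end TimeChart

/-! ### The plateaus of the Sergeraert field -/

theorem vSeq_pos (n : ℕ) : 0 < vSeq n := zpow_pos two_pos _

theorem vSeq_le_one (n : ℕ) : vSeq n ≤ 1 :=
  zpow_le_one_of_nonpos₀ one_le_two (by simp)

theorem wSeq_pos (n : ℕ) : 0 < wSeq n := zpow_pos two_pos _

theorem tendsto_inv_vSeq_pow_mul_wSeq (M : ℕ) :
    Tendsto (fun n => (vSeq n)⁻¹ ^ M * wSeq n) atTop (𝓝 0) := by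
  refine squeeze_zero' (g := fun n : ℕ => (1 / 2 : ℝ) ^ n)
    (Eventually.of_forall fun n => by have := vSeq_pos n; have := wSeq_pos n; positivity) ?_
    (tendsto_pow_atTop_nhds_zero_of_lt_one (by norm_num) (by norm_num))
  filter_upwards [eventually_ge_atTop (M + 1)] with n hn
  have h1 : (vSeq n)⁻¹ ^ M * wSeq n = (2 : ℝ) ^ ((n : ℤ) ^ 2 * M - (n : ℤ) ^ 3) := by
    rw [vSeq, wSeq, zpow_neg, inv_inv, ← zpow_natCast, ← zpow_mul, ← zpow_add₀ two_ne_zero,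
      sub_eq_add_neg]
  have h2 : (1 / 2 : ℝ) ^ n = (2 : ℝ) ^ (-(n : ℤ)) := by
    rw [zpow_neg, zpow_natCast, one_div, inv_pow]
  rw [h1, h2]
  refine zpow_le_zpow_right₀ one_le_two ?_
  have hn' : (M : ℤ) + 1 ≤ n := by exact_mod_cast hn
  have hM : (0 : ℤ) ≤ M := M.cast_nonneg
  nlinarith [mul_le_mul_of_nonneg_left hn' (sq_nonneg (n : ℤ))]

theorem IsSergeraertField.eq_neg_vSeq {α β ξ₀ : ℝ → ℝ} (hξ : IsSergeraertField α β ξ₀)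
    (hαβ : IsBumpPair α β) (n : ℕ) {x : ℝ}
    (hx : x ∈ Icc ((2 : ℝ) ^ (-(n : ℤ) - 1) + (2 : ℝ) ^ (-(n : ℤ) - 1) / 3)
      ((2 : ℝ) ^ (-(n : ℤ)) - (2 : ℝ) ^ (-(n : ℤ) - 1) / 3)) : ξ₀ x = -vSeq n := by
  obtain ⟨-, -, -, -, -, hα, -, -, hβ⟩ := hαβ
  have hA : (0 : ℝ) < 2 ^ (-(n : ℤ) - 1) := zpow_pos two_pos _
  have h2 : (2 : ℝ) ^ (-(n : ℤ)) = 2 ^ (-(n : ℤ) - 1) * 2 := by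
    rw [← zpow_add_one₀ two_ne_zero, sub_add_cancel]
  have h1 : (2 : ℝ) ^ (n + 1) * 2 ^ (-(n : ℤ) - 1) = 1 := by
    rw [← zpow_natCast, ← zpow_add₀ two_ne_zero]
    simp
  have hx' := hx
  rw [h2] at hx'
  have hp : (0 : ℝ) < 2 ^ (n + 1) := by positivity
  have h3 : (2 : ℝ) ^ (n + 1) * x - 1 ∈ Icc (1 / 3 : ℝ) (2 / 3) := by
    have := mul_le_mul_of_nonneg_left hx'.1 hp.le
    have := mul_le_mul_of_nonneg_left hx'.2 hp.le
    constructor <;> nlinarith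
  rw [hξ.2.2 n x ⟨by linarith [hx.1], by linarith [hx.2]⟩, hα _ h3.1, hβ _ h3]
  ring

theorem TimeChart.apply_add_of_plateau {ξ₀ ψ : ℝ → ℝ} (hc : TimeChart ξ₀ ψ) {t v : ℝ}
    (h : ∀ x ∈ Icc (ψ (t + 2)) (ψ (t - 1)), ξ₀ x = -v) {τ : ℝ} (hτ : τ ∈ Icc (-1 : ℝ) 2) :
    ψ (t + τ) = ψ t - v * τ := by
  have hd : ∀ τ ∈ Icc (-1 : ℝ) 2, HasDerivAt (fun τ => ψ (t + τ) + v * τ) 0 τ := by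
    intro τ hτ
    have h1 := ((hc.deriv (t + τ)).comp_const_add t τ).add ((hasDerivAt_id τ).const_mul v)
    rwa [h _ ⟨hc.strictAnti.antitone (by linarith [hτ.2]),
      hc.strictAnti.antitone (by linarith [hτ.1])⟩, mul_one, neg_add_cancel] at h1
  have hconst := constant_of_has_deriv_right_zero
    (fun τ hτ => (hd τ hτ).continuousAt.continuousWithinAt)
    fun τ hτ => (hd τ (Ico_subset_Icc_self hτ)).hasDerivWithinAt
  have h1 := hconst τ hτ
  have h0 := hconst 0 (by norm_num)
  simp only [add_zero, mul_zero] at h0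
  linarith

theorem TimeChart.eventually_le_of_apply_le {ξ₀ ψ : ℝ → ℝ} (hc : TimeChart ξ₀ ψ) {t : ℕ → ℝ}
    (h : ∀ᶠ n in atTop, ψ (t n) ≤ (2 : ℝ) ^ (-(n : ℤ))) (T : ℝ) : ∀ᶠ n in atTop, T ≤ t n := by
  have h0 : Tendsto (fun n : ℕ => (2 : ℝ) ^ (-(n : ℤ))) atTop (𝓝 0) := by
    have := tendsto_pow_atTop_nhds_zero_of_lt_one (r := (1 / 2 : ℝ)) (by norm_num) (by norm_num)
    simpa [zpow_neg] using this
  filter_upwards [h, h0.eventually_lt_const (hc.pos T)] with n h1 h2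
  exact (hc.strictAnti.lt_iff_gt.1 (h1.trans_lt h2)).le

theorem TimeChart.eventually_kick_estimates {γ ξ₀ ψ Φ : ℝ → ℝ} {q : ℕ} (hc : TimeChart ξ₀ ψ)
    (hγ : ∀ t : ℝ, t ∉ Icc (-(1 / 4) : ℝ) (1 / 4) → γ t = 0)
    (hs : ContDiff ℝ ((⊤ : ℕ∞) : WithTop ℕ∞) γ) (hq : 0 < q) (hΦ : TameDiffeo Φ) {j : ℕ → ℤ}
    (hj : ∀ T : ℝ, ∀ᶠ n in atTop, T ≤ j n - 1)
    (haff : ∀ᶠ n in atTop, ∀ τ ∈ Icc (-1 : ℝ) 2, ψ (j n + τ) = ψ (j n) - vSeq n * τ)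
    (M : ℕ) {ε : ℝ} (hε : 0 < ε) :
    ∀ᶠ n in atTop, TameDiffeo (kickAt γ q (wSeq n) (j n) ∘ Φ) ∧
      (∀ i ≤ M, ∀ t,
        |iteratedDeriv i (fun t => (kickAt γ q (wSeq n) (j n) ∘ Φ) t - Φ t) t| ≤ ε) ∧
      (∀ i ≤ 1, ∀ x ∈ Ici (0 : ℝ), |iteratedDerivWithin i (fun x =>
        conjField ξ₀ ψ (kickAt γ q (wSeq n) (j n) ∘ Φ) x - conjField ξ₀ ψ Φ x) (Ici 0) x| ≤ ε) ∧
      (∀ m ≤ q, ∀ i ≤ M, ∀ x ∈ Ici (0 : ℝ), |iteratedDerivWithin i (fun x =>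
        conjFlow ψ (kickAt γ q (wSeq n) (j n) ∘ Φ) (m / q) x - conjFlow ψ Φ (m / q) x)
          (Ici 0) x| ≤ ε) := by
  obtain ⟨w₀, hw₀, -, hthr⟩ := exists_kick_threshold hγ hs q
  obtain ⟨T, hT⟩ := hΦ.ident
  obtain ⟨C₁, hC₁⟩ := exists_kickAt_comp_sub_bound hγ hs hq hΦ M
  obtain ⟨C₂, hC₂⟩ := hc.exists_conjField_sub_bound hγ hs hq hΦ hthr
  obtain ⟨C₃, hC₃⟩ := hc.exists_conjFlow_sub_bound hγ hs hq hΦ hthr hT M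
  have hw : Tendsto wSeq atTop (𝓝 0) := by simpa using tendsto_inv_vSeq_pow_mul_wSeq 0
  have h1 : ∀ᶠ n in atTop, wSeq n * C₁ < ε :=
    Tendsto.eventually_lt_const (by simpa using hε) (hw.mul_const C₁)
  have h2 : ∀ᶠ n in atTop, wSeq n * C₂ < ε :=
    Tendsto.eventually_lt_const (by simpa using hε) (hw.mul_const C₂)
  have h3 : ∀ᶠ n in atTop, (vSeq n)⁻¹ ^ M * wSeq n * C₃ < ε :=
    Tendsto.eventually_lt_const (by simpa using hε)
      ((tendsto_inv_vSeq_pow_mul_wSeq M).mul_const C₃)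
  filter_upwards [h1, h2, h3, hw.eventually_lt_const hw₀, hj T, haff] with n h1 h2 h3 h4 h5 h6
  have hmem : wSeq n ∈ Icc 0 w₀ := ⟨(wSeq_pos n).le, h4.le⟩
  exact ⟨hΦ.kickAt_comp hγ hs hq (hthr _ hmem) _,
    fun i hi t => (hC₁ _ hmem.1 _ i hi t).trans h1.le,
    fun i hi x hx => (hC₂ _ hmem _ i hi x hx).trans h2.le,
    fun m hm i hi x hx => (hC₃ _ hmem _ h5 _ (vSeq_pos n) (vSeq_le_one n) h6 m hm i hi x hx).trans
      h3.le⟩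

/-! ### Regularity of the flow in the time variable -/

theorem UnifTame.unifBdd_slope {H : ℝ → ℝ} {T : ℝ}
    (hH : UnifTame (Iio (T + 1)) (fun _ : Unit => H)) {s₀ : ℝ} (hs₀ : s₀ ∈ Icc (0 : ℝ) 1) :
    UnifBdd (Iio T) (fun (s : Icc (0 : ℝ) 1) y => ((s : ℝ) - s₀)⁻¹ * (H (y + s) - H (y + s₀))) := by
  have hmem : ∀ s ∈ Icc (0 : ℝ) 1, ∀ y ∈ Iio T, y + s ∈ Iio (T + 1) := fun s hs y hy =>
    add_lt_add_of_lt_of_le hy hs.2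
  have hsm : ∀ s ∈ Icc (0 : ℝ) 1,
      ContDiffOn ℝ ((⊤ : ℕ∞) : WithTop ℕ∞) (fun y => H (y + s)) (Iio T) :=
    fun s hs => (hH.smooth ()).comp (contDiff_id.add contDiff_const).contDiffOn (hmem s hs)
  refine ⟨fun s => contDiffOn_const.mul ((hsm s s.2).sub (hsm s₀ hs₀)), fun m => ?_⟩
  obtain ⟨C, hC⟩ := hH.bdd m
  refine ⟨C, fun s y hy => ?_⟩
  have hat : ∀ s ∈ Icc (0 : ℝ) 1, ContDiffAt ℝ m (fun y => H (y + s)) y := fun s hs =>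
    ((hsm s hs).contDiffAt (Iio_mem_nhds hy)).of_le (by exact_mod_cast le_top)
  have hd : ∀ x ∈ Iio (T + 1), DifferentiableAt ℝ (iteratedDeriv m H) x := fun x hx =>
    (((((hH.smooth ()).differentiableOn_iteratedDerivWithin (m := m)
      (by exact_mod_cast WithTop.coe_lt_top m) isOpen_Iio.uniqueDiffOn).congr fun z hz =>
        (iteratedDerivWithin_of_isOpen isOpen_Iio hz).symm) x hx).differentiableAt
      (Iio_mem_nhds hx))
  have hmvt := (convex_Iio (T + 1)).norm_image_sub_le_of_norm_deriv_le hd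
    (fun x hx => by rw [← iteratedDeriv_succ]; exact hC () x hx)
    (hmem s₀ hs₀ y hy) (hmem s s.2 y hy)
  rw [Real.norm_eq_abs, Real.norm_eq_abs, add_sub_add_left_eq_sub] at hmvt
  have hsub := iteratedDeriv_sub (hat s s.2) (hat s₀ hs₀)
  rw [iteratedDeriv_comp_add_const, iteratedDeriv_comp_add_const] at hsub
  rw [iteratedDeriv_const_mul_field]
  change |_ * iteratedDeriv m ((fun y => H (y + s)) - fun y => H (y + s₀)) y| ≤ C
  rw [hsub, abs_mul, abs_inv]
  have hC0 : 0 ≤ C := (abs_nonneg _).trans (hC () _ (hmem s₀ hs₀ y hy))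
  calc _ ≤ |(s : ℝ) - s₀|⁻¹ * (C * |(s : ℝ) - s₀|) := by gcongr
    _ = C * (|(s : ℝ) - s₀|⁻¹ * |(s : ℝ) - s₀|) := by ring
    _ ≤ C * 1 := by
      gcongr
      exact inv_mul_le_one
    _ = C := mul_one C

namespace TimeChart

variable {ξ₀ ψ Φ Φ' : ℝ → ℝ}

theorem exists_conjFlow_lipschitz (hc : TimeChart ξ₀ ψ) (hΦ : TameDiffeo Φ) {c : ℝ} (h : 0 < c)
    {s₀ : ℝ} (hs₀ : s₀ ∈ Icc (0 : ℝ) 1) (M : ℕ) :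
    ∃ C, 0 ≤ C ∧ ∀ s ∈ Icc (0 : ℝ) 1,
      ContDiffOn ℝ ((⊤ : ℕ∞) : WithTop ℕ∞) (conjFlow ψ Φ s) (Ioi c) ∧
      ∀ i ≤ M, ∀ x ∈ Ioi c,
        |iteratedDeriv i (conjFlow ψ Φ s - conjFlow ψ Φ s₀) x| ≤ |s - s₀| * C := by
  let g := Φ ∘ Function.invFun ψ
  let H := ψ ∘ Function.invFun Φ
  let T := Φ (Function.invFun ψ c)
  have hg : UnifTame (Ioi c) (fun _ : Unit => g) :=
    hΦ.tame.comp isOpen_Ioi isOpen_univ (hc.tame_invFun h) fun _ => mapsTo_univ _ _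
  have hgm : MapsTo g (Ioi c) (Iio T) := fun x hx =>
    hΦ.strictMono (hc.strictAntiOn_invFun h (h.trans hx) hx)
  have hH : UnifTame (Iio (T + 1)) (fun _ : Unit => H) :=
    (hc.tame _).comp isOpen_Iio isOpen_Iio (hΦ.tame_invFun.mono (subset_univ _))
      fun _ x hx => hΦ.strictMono_invFun hx
  have hflow : ∀ s, EqOn (conjFlow ψ Φ s) (fun x => H (g x + s)) (Ioi c) := fun s x hx => by
    obtain ⟨t, rfl⟩ := hc.exists_eq (h.trans hx)
    simp only [hc.conjFlow_apply, H, g, Function.comp_apply, hc.invFun_apply]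
  obtain ⟨C, hC1, hC⟩ := UnifDerivBdd.exists_common (m := M) fun l _ =>
    ((hH.unifBdd_slope hs₀).comp isOpen_Ioi isOpen_Iio (hg.reindex fun _ => ()) fun _ => hgm).bdd l
  refine ⟨C, by linarith, fun s hs => ⟨?_, fun i hi x hx => ?_⟩⟩
  · exact ((hH.smooth ()).comp ((hg.smooth ()).add contDiffOn_const)
      fun x hx => add_lt_add_of_lt_of_le (hgm hx) hs.2).congr (hflow s)
  · have hloc : conjFlow ψ Φ s - conjFlow ψ Φ s₀ =ᶠ[𝓝 x] fun x =>
        (s - s₀) * ((fun y => (s - s₀)⁻¹ * (H (y + s) - H (y + s₀))) ∘ g) x := by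
      filter_upwards [Ioi_mem_nhds hx] with y hy
      rw [Pi.sub_apply, hflow s hy, hflow s₀ hy, Function.comp_apply]
      rcases eq_or_ne s s₀ with rfl | hne
      · simp
      · rw [mul_inv_cancel_left₀ (sub_ne_zero.2 hne)]
    rw [hloc.iteratedDeriv_eq, iteratedDeriv_const_mul_field, abs_mul]
    exact mul_le_mul_of_nonneg_left (hC i hi ⟨s, hs⟩ x hx) (abs_nonneg _)

theorem conjFlow_eq_of_ident (hc : TimeChart ξ₀ ψ) (hΦ : TameDiffeo Φ) {T : ℝ}
    (hT : ∀ t ≥ T, Φ t = t) {s t : ℝ} (hs : 0 ≤ s) (ht : T ≤ t) :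
    conjFlow ψ Φ s (ψ t) = ψ (t + s) := by
  rw [hc.conjFlow_apply, hT t ht, hΦ.invFun_eq_self (hT (t + s) (by linarith))]

theorem exists_conjFlow_sub_le (hc : TimeChart ξ₀ ψ) (hΦ : TameDiffeo Φ) (hΦ' : TameDiffeo Φ')
    {s₀ : ℝ} (hs₀ : s₀ ∈ Icc (0 : ℝ) 1) (M : ℕ) {ε : ℝ} (hε : 0 < ε)
    (hest : ∀ i ≤ M, ∀ x ∈ Ici (0 : ℝ), |iteratedDerivWithin i
      (fun x => conjFlow ψ Φ' s₀ x - conjFlow ψ Φ s₀ x) (Ici 0) x| ≤ ε) :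
    ∃ δ > 0, ∀ s ∈ Icc (0 : ℝ) 1, |s - s₀| ≤ δ → ∀ i ≤ M, ∀ x ∈ Ici (0 : ℝ),
      |iteratedDerivWithin i (fun x => conjFlow ψ Φ' s x - conjFlow ψ Φ s x) (Ici 0) x| ≤
        2 * ε := by
  obtain ⟨T₁, hT₁⟩ := hΦ.ident
  obtain ⟨T₂, hT₂⟩ := hΦ'.ident
  set T := max T₁ T₂
  have hT : 0 < ψ T / 2 := half_pos (hc.pos T)
  obtain ⟨C, hC0, hC⟩ := hc.exists_conjFlow_lipschitz hΦ hT hs₀ M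
  obtain ⟨C', hC0', hC'⟩ := hc.exists_conjFlow_lipschitz hΦ' hT hs₀ M
  refine ⟨ε / (C + C' + 1), by positivity, fun s hs hδ i hi x hx => ?_⟩
  rcases lt_or_ge x (ψ T) with hx1 | hx1
  · have hzero : EqOn (fun x => conjFlow ψ Φ' s x - conjFlow ψ Φ s x) (fun _ => 0)
        (Ico 0 (ψ T)) := by
      intro y hy
      rcases hy.1.eq_or_lt with rfl | h0
      · simp [conjFlow, conjHalfLine_zero]
      · obtain ⟨t, rfl⟩ := hc.exists_eq h0
        have ht := max_le_iff.1 (hc.strictAnti.lt_iff_gt.1 hy.2).le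
        simp only [hc.conjFlow_eq_of_ident hΦ hT₁ hs.1 ht.1,
          hc.conjFlow_eq_of_ident hΦ' hT₂ hs.1 ht.2, sub_self]
    have hev : (fun x => conjFlow ψ Φ' s x - conjFlow ψ Φ s x) =ᶠ[𝓝[Ici 0] x] fun _ => 0 :=
      hzero.eventuallyEq_of_mem
        (inter_mem_nhdsWithin (Ici 0) (Iio_mem_nhds hx1))
    rw [hev.iteratedDerivWithin_eq (hzero ⟨hx, hx1⟩), iteratedDerivWithin_const, ite_self, abs_zero]
    positivity
  · have hxc : x ∈ Ioi (ψ T / 2) := (half_lt_self (hc.pos T)).trans_le hx1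
    have hat : ∀ s ∈ Icc (0 : ℝ) 1, ContDiffAt ℝ i (conjFlow ψ Φ s) x ∧
        ContDiffAt ℝ i (conjFlow ψ Φ' s) x := fun s hs =>
      ⟨((hC s hs).1.contDiffAt (Ioi_mem_nhds hxc)).of_le (by exact_mod_cast le_top),
        ((hC' s hs).1.contDiffAt (Ioi_mem_nhds hxc)).of_le (by exact_mod_cast le_top)⟩
    have hwithin : ∀ s ∈ Icc (0 : ℝ) 1,
        iteratedDerivWithin i (fun x => conjFlow ψ Φ' s x - conjFlow ψ Φ s x) (Ici 0) x =
          iteratedDeriv i (conjFlow ψ Φ' s) x - iteratedDeriv i (conjFlow ψ Φ s) x :=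
      fun s hs => (iteratedDerivWithin_eq_iteratedDeriv (uniqueDiffOn_Ici 0)
        ((hat s hs).2.sub (hat s hs).1) hx).trans (iteratedDeriv_sub (hat s hs).2 (hat s hs).1)
    have h0 := hest i hi x hx
    have h1 := (hC s hs).2 i hi x hxc
    have h2 := (hC' s hs).2 i hi x hxc
    rw [hwithin s₀ hs₀] at h0
    rw [iteratedDeriv_sub (hat s hs).1 (hat s₀ hs₀).1] at h1
    rw [iteratedDeriv_sub (hat s hs).2 (hat s₀ hs₀).2] at h2
    rw [hwithin s hs]
    have h3 : |s - s₀| * C + |s - s₀| * C' ≤ ε := by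
      rw [le_div_iff₀ (by positivity)] at hδ
      nlinarith [abs_nonneg (s - s₀)]
    rw [abs_le] at h0 h1 h2 ⊢
    constructor <;> linarith

end TimeChart

/-! ### The Cantor scheme and the recursion -/

/-- `I ⊆ [0,1]` is a union of `2 ^ k` pairwise disjoint nondegenerate closed intervals. -/
def IsDyadicIntervalUnion (k : ℕ) (I : Set ℝ) : Prop :=
  ∃ lo hi : Fin (2 ^ k) → ℝ, (∀ i, lo i < hi i) ∧
    (Pairwise fun i i' => Disjoint (Icc (lo i) (hi i)) (Icc (lo i') (hi i'))) ∧
    I = (⋃ i, Icc (lo i) (hi i)) ∧ I ⊆ Icc 0 1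

theorem isDyadicIntervalUnion_zero : IsDyadicIntervalUnion 0 (Icc 0 1) := by
  refine ⟨fun _ => 0, fun _ => 1, fun _ => one_pos, fun i i' h => ?_, ?_, Subset.rfl⟩
  · exact absurd (Subsingleton.elim (α := Fin 1) i i') h
  · exact (iUnion_const (ι := Fin 1) _).symm

theorem connectedComponentIn_iUnion_Icc {ι : Type*} [Finite ι] {lo hi : ι → ℝ}
    (hdisj : Pairwise fun i i' => Disjoint (Icc (lo i) (hi i)) (Icc (lo i') (hi i')))
    {i : ι} {x : ℝ} (hx : x ∈ Icc (lo i) (hi i)) :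
    connectedComponentIn (⋃ i, Icc (lo i) (hi i)) x = Icc (lo i) (hi i) := by
  have hxF : x ∈ ⋃ i, Icc (lo i) (hi i) := mem_iUnion_of_mem i hx
  refine Subset.antisymm ?_ (isPreconnected_Icc.subset_connectedComponentIn hx
    (subset_iUnion (fun i => Icc (lo i) (hi i)) i))
  have hB : IsClosed (⋃ j : {j // j ≠ i}, Icc (lo j) (hi j)) :=
    isClosed_iUnion_of_finite fun _ => isClosed_Icc
  have hd : Disjoint (Icc (lo i) (hi i)) (⋃ j : {j // j ≠ i}, Icc (lo j) (hi j)) :=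
    disjoint_iUnion_right.2 fun j => hdisj j.2.symm
  have hcov : connectedComponentIn (⋃ i, Icc (lo i) (hi i)) x ⊆
      Icc (lo i) (hi i) ∪ ⋃ j : {j // j ≠ i}, Icc (lo j) (hi j) := fun y hy => by
    obtain ⟨j, hj⟩ := mem_iUnion.1 (connectedComponentIn_subset _ _ hy)
    rcases eq_or_ne j i with rfl | hne
    · exact Or.inl hj
    · exact Or.inr (mem_iUnion_of_mem ⟨j, hne⟩ hj)
  rcases isPreconnected_iff_subset_of_disjoint_closed.1 isPreconnected_connectedComponentIn
    _ _ isClosed_Icc hB hcov (by rw [hd.inter_eq, inter_empty]) with h | h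
  · exact h
  · exact absurd (h (mem_connectedComponentIn hxF)) (disjoint_left.1 hd hx)

/-- Small intervals around two points of each component form the next Cantor step. -/
theorem exists_cantorStep {k : ℕ} {lo hi : Fin (2 ^ k) → ℝ}
    (hdisj : Pairwise fun i i' => Disjoint (Icc (lo i) (hi i)) (Icc (lo i') (hi i')))
    (hsub : (⋃ i, Icc (lo i) (hi i)) ⊆ Icc 0 1) {r : ℝ} {c δ : Fin (2 ^ k) × Bool → ℝ}
    (hc : ∀ p, c p ∈ Ioo (lo p.1) (hi p.1)) (hne : ∀ i, c (i, false) ≠ c (i, true))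
    (hr : ∀ p, c p ≠ r) (hδ : ∀ p, 0 < δ p) :
    ∃ I : Set ℝ, CantorStep (⋃ i, Icc (lo i) (hi i)) I (k + 1) r ∧
      IsDyadicIntervalUnion (k + 1) I ∧ ∀ s ∈ I, ∃ p, |s - c p| ≤ δ p := by
  have hinj : Function.Injective c := by
    rintro ⟨i, b⟩ ⟨i', b'⟩ h
    have hi : i = i' := by
      by_contra hii
      exact disjoint_left.1 (hdisj hii) (Ioo_subset_Icc_self (hc (i, b)))
        (h ▸ Ioo_subset_Icc_self (hc (i', b')))
    subst hi
    cases b <;> cases b' <;> first | rfl | exact absurd h (hne i) | exact absurd h.symm (hne i)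
  have hsmall : ∀ {d : ℝ}, 0 < d → ∀ᶠ ρ in 𝓝[>] (0 : ℝ), ρ < d := fun hd =>
    (eventually_lt_nhds hd).filter_mono nhdsWithin_le_nhds
  obtain ⟨ρ, ⟨h1, h2⟩, hρ⟩ := (((eventually_all.2 fun p =>
    (hsmall (sub_pos.2 (hc p).1)).and ((hsmall (sub_pos.2 (hc p).2)).and
      ((hsmall (abs_pos.2 (sub_ne_zero.2 (hr p)))).and (hsmall (hδ p))))).and
    (eventually_all.2 fun z : {z : (Fin (2 ^ k) × Bool) × (Fin (2 ^ k) × Bool) // z.1 ≠ z.2} =>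
      hsmall (half_pos (abs_pos.2 (sub_ne_zero.2 (hinj.ne z.2)))))).and
    self_mem_nhdsWithin).exists
  have hρ : 0 < ρ := hρ
  let e : Fin (2 ^ (k + 1)) ≃ Fin (2 ^ k) × Bool := Fintype.equivOfCardEq (by simp [pow_succ])
  have hmem : ∀ m s, s ∈ Icc (c (e m) - ρ) (c (e m) + ρ) → |s - c (e m)| ≤ ρ := fun m s hs =>
    abs_sub_le_iff.2 ⟨by linarith [hs.2], by linarith [hs.1]⟩
  have hin : ∀ m, Icc (c (e m) - ρ) (c (e m) + ρ) ⊆ Icc (lo (e m).1) (hi (e m).1) := fun m =>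
    Icc_subset_Icc (by linarith [(h1 (e m)).1]) (by linarith [(h1 (e m)).2.1])
  have hlt : ∀ m, c (e m) - ρ < c (e m) + ρ := fun m => by linarith
  have hdisj' : Pairwise fun m m' => Disjoint (Icc (c (e m) - ρ) (c (e m) + ρ))
      (Icc (c (e m') - ρ) (c (e m') + ρ)) := fun m m' hmm => disjoint_left.2 fun s hs hs' => by
    have h := h2 ⟨(e m, e m'), e.injective.ne hmm⟩
    have := abs_sub_le (c (e m)) s (c (e m'))
    rw [abs_sub_comm (c (e m)) s] at this
    dsimp only at h
    linarith [hmem m s hs, hmem m' s hs']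
  have hsub' : (⋃ m, Icc (c (e m) - ρ) (c (e m) + ρ)) ⊆ ⋃ i, Icc (lo i) (hi i) :=
    iUnion_subset fun m => (hin m).trans (subset_iUnion (fun i => Icc (lo i) (hi i)) _)
  refine ⟨⋃ m, Icc (c (e m) - ρ) (c (e m) + ρ), ⟨isCompact_iUnion fun _ => isCompact_Icc, hsub', ?_,
    _, _, hlt, hdisj', rfl, ?_⟩, ⟨_, _, hlt, hdisj', rfl, hsub'.trans hsub⟩, ?_⟩
  · intro h
    obtain ⟨m, hm⟩ := mem_iUnion.1 h
    have := hmem m r hm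
    rw [abs_sub_comm] at this
    exact absurd (h1 (e m)).2.2.1 this.not_gt
  · intro x hx
    obtain ⟨i, hi'⟩ := mem_iUnion.1 hx
    rw [connectedComponentIn_iUnion_Icc hdisj hi']
    have hiff : ∀ m, Icc (c (e m) - ρ) (c (e m) + ρ) ⊆ Icc (lo i) (hi i) ↔ (e m).1 = i := by
      refine fun m => ⟨fun h => ?_, fun h => h ▸ hin m⟩
      by_contra hne'
      have hcm : c (e m) ∈ Icc (c (e m) - ρ) (c (e m) + ρ) := ⟨by linarith, by linarith⟩
      exact disjoint_left.1 (hdisj hne') (hin m hcm) (h hcm)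
    have hfib : {m // Icc (c (e m) - ρ) (c (e m) + ρ) ⊆ Icc (lo i) (hi i)} ≃ Bool :=
      (e.subtypeEquiv (q := fun p => p.1 = i) hiff).trans
        { toFun := fun p => p.1.2
          invFun := fun b => ⟨(i, b), rfl⟩
          left_inv := fun ⟨⟨_, _⟩, h⟩ => by cases h; rfl
          right_inv := fun _ => rfl }
    rw [Nat.card_congr hfib, Nat.card_eq_fintype_card, Fintype.card_bool]
  · intro s hs
    obtain ⟨m, hm⟩ := mem_iUnion.1 hs
    exact ⟨e m, (hmem m s hm).trans (h1 (e m)).2.2.2.le⟩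

theorem exists_two_fractions_mem_Ioo {a b : ℝ} (ha : 0 ≤ a) {q : ℕ} (hq : 0 < q)
    (h : 3 < q * (b - a)) (r : ℝ) :
    ∃ m : Bool → ℕ, (∀ b', (m b' : ℝ) / q ∈ Ioo a b ∧ (m b' : ℝ) / q ≠ r) ∧
      (m false : ℝ) / q ≠ (m true : ℝ) / q := by
  have hq' : (0 : ℝ) < q := by exact_mod_cast hq
  set z := ⌊q * a⌋₊
  have h1 : (z : ℝ) ≤ q * a := Nat.floor_le (by positivity)
  have h2 : q * a < z + 1 := Nat.lt_floor_add_one _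
  have hIoo : ∀ l ∈ Finset.Icc 1 3, ((z + l : ℕ) : ℝ) / q ∈ Ioo a b := fun l hl => by
    rw [Finset.mem_Icc] at hl
    have hl1 : (1 : ℝ) ≤ l := by exact_mod_cast hl.1
    have hl3 : (l : ℝ) ≤ 3 := by exact_mod_cast hl.2
    push_cast
    exact ⟨(lt_div_iff₀ hq').2 (by linarith), (div_lt_iff₀ hq').2 (by linarith)⟩
  have hinj : ∀ {l l' : ℕ}, l ≠ l' → ((z + l : ℕ) : ℝ) / q ≠ ((z + l' : ℕ) : ℝ) / q :=
    fun hll h => hll (by simpa [div_left_inj' hq'.ne'] using h)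
  have key : ∀ l ∈ Finset.Icc 1 3, ∀ l' ∈ Finset.Icc 1 3, l ≠ l' → ((z + l : ℕ) : ℝ) / q ≠ r →
      ((z + l' : ℕ) : ℝ) / q ≠ r →
      ∃ m : Bool → ℕ, (∀ b', (m b' : ℝ) / q ∈ Ioo a b ∧ (m b' : ℝ) / q ≠ r) ∧
        (m false : ℝ) / q ≠ (m true : ℝ) / q := fun l hl l' hl' hne hr hr' =>
    ⟨fun b' => if b' then z + l else z + l', by
      rintro (_ | _)
      · simpa only [Bool.false_eq_true, if_false] using ⟨hIoo l' hl', hr'⟩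
      · simpa only [if_true] using ⟨hIoo l hl, hr⟩,
      by simpa only [Bool.false_eq_true, if_false, if_true] using hinj hne.symm⟩
  by_cases hr1 : ((z + 1 : ℕ) : ℝ) / q = r
  · exact key 2 (by simp) 3 (by simp) (by simp) (hr1 ▸ hinj (by simp)) (hr1 ▸ hinj (by simp))
  · by_cases hr2 : ((z + 2 : ℕ) : ℝ) / q = r
    · exact key 1 (by simp) 3 (by simp) (by simp) hr1 (hr2 ▸ hinj (by simp))
    · exact key 1 (by simp) 2 (by simp) (by simp) hr1 hr2

/-- One step of the approximation-by-conjugation construction. -/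
theorem TimeChart.exists_step {γ ξ₀ ψ Φ : ℝ → ℝ} (hc : TimeChart ξ₀ ψ)
    (hγ : ∀ t : ℝ, t ∉ Icc (-(1 / 4) : ℝ) (1 / 4) → γ t = 0)
    (hs : ContDiff ℝ ((⊤ : ℕ∞) : WithTop ℕ∞) γ) (hΦ : TameDiffeo Φ) {j : ℕ → ℤ}
    (hj : ∀ T : ℝ, ∀ᶠ n in atTop, T ≤ j n - 1)
    (haff : ∀ᶠ n in atTop, ∀ τ ∈ Icc (-1 : ℝ) 2, ψ (j n + τ) = ψ (j n) - vSeq n * τ)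
    {k : ℕ} {I : Set ℝ} (hI : IsDyadicIntervalUnion k I) (q₀ n₀ : ℕ) (r : ℝ)
    (M : ℕ) {ε : ℝ} (hε : 0 < ε) :
    ∃ (q n : ℕ) (I' : Set ℝ), q₀ < q ∧ Odd q ∧ n₀ < n ∧ CantorStep I I' (k + 1) r ∧
      IsDyadicIntervalUnion (k + 1) I' ∧ TameDiffeo (kickAt γ q (wSeq n) (j n) ∘ Φ) ∧
      (∀ i ≤ M, ∀ t,
        |iteratedDeriv i (fun t => (kickAt γ q (wSeq n) (j n) ∘ Φ) t - Φ t) t| ≤ ε) ∧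
      (∀ i ≤ 1, ∀ x ∈ Ici (0 : ℝ), |iteratedDerivWithin i (fun x =>
        conjField ξ₀ ψ (kickAt γ q (wSeq n) (j n) ∘ Φ) x - conjField ξ₀ ψ Φ x) (Ici 0) x| ≤ ε) ∧
      (∀ s ∈ I' ∪ {1}, ∀ i ≤ M, ∀ x ∈ Ici (0 : ℝ), |iteratedDerivWithin i (fun x =>
        conjFlow ψ (kickAt γ q (wSeq n) (j n) ∘ Φ) s x - conjFlow ψ Φ s x) (Ici 0) x| ≤
          2 * ε) := by
  obtain ⟨lo, hi, hlt, hdisj, rfl, hsub⟩ := hI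
  obtain ⟨N, hN⟩ := eventually_atTop.1 (eventually_all.2 fun i =>
    (tendsto_natCast_atTop_atTop.atTop_mul_const (sub_pos.2 (hlt i))).eventually_gt_atTop 3)
  set q := 2 * (N + q₀) + 1
  have hq : 0 < q := Nat.succ_pos _
  have hq' : (0 : ℝ) < q := by exact_mod_cast hq
  have hunit : ∀ i, Icc (lo i) (hi i) ⊆ Icc 0 1 := fun i =>
    (subset_iUnion (fun i => Icc (lo i) (hi i)) i).trans hsub
  choose m hm hm' using fun i => exists_two_fractions_mem_Ioo
    (hunit i (left_mem_Icc.2 (hlt i).le)).1 hq (hN q (by omega) i) r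
  obtain ⟨n, ⟨hT, hest₀, hest₁, hest₂⟩, hn⟩ :=
    ((hc.eventually_kick_estimates hγ hs hq hΦ hj haff M hε).and (eventually_gt_atTop n₀)).exists
  have hc01 : ∀ p : Fin (2 ^ k) × Bool, (m p.1 p.2 : ℝ) / q ∈ Icc (0 : ℝ) 1 := fun p =>
    hunit p.1 (Ioo_subset_Icc_self (hm p.1 p.2).1)
  choose δ hδ hδ' using fun p : Fin (2 ^ k) × Bool =>
    hc.exists_conjFlow_sub_le hΦ hT (hc01 p) M hε
      (hest₂ (m p.1 p.2) (by exact_mod_cast (div_le_one hq').1 (hc01 p).2))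
  obtain ⟨I', hstep, hI', hnear⟩ := exists_cantorStep hdisj hsub
    (c := fun p => (m p.1 p.2 : ℝ) / q) (fun p => (hm p.1 p.2).1) hm'
    (fun p => (hm p.1 p.2).2) hδ
  refine ⟨q, n, I', by omega, odd_two_mul_add_one _, hn, hstep, hI', hT, hest₀, hest₁, ?_⟩
  rintro s (hsI | rfl) i hi' x hx
  · obtain ⟨p, hp⟩ := hnear s hsI
    exact hδ' p s (hsub (hstep.2.1 hsI)) hp i hi' x hx
  · have := hest₂ q le_rfl i hi' x hx
    rw [div_self hq'.ne'] at this
    linarith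

theorem exists_seq_of_step {X : Type*} {P : ℕ → X → Prop} {R : ℕ → X → X → Prop} {x₀ : X}
    (h₀ : P 0 x₀) (h : ∀ k x, P k x → ∃ y, P (k + 1) y ∧ R k x y) :
    ∃ u : ℕ → X, u 0 = x₀ ∧ ∀ k, P k (u k) ∧ R k (u k) (u (k + 1)) := by
  choose! f hf hR using h
  let u : ℕ → X := fun k => Nat.rec x₀ f k
  have hP : ∀ k, P k (u k) := fun k => by
    induction k with
    | zero => exact h₀
    | succ k ih => exact hf k _ ih
  exact ⟨u, rfl, fun k => ⟨hP k, hR k _ (hP k)⟩⟩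

/-- The variables of the recursion: `q_k`, `n_k`, `Φ_k` and `I_k`. -/
structure ConjugationStage where
  q : ℕ
  n : ℕ
  Φ : ℝ → ℝ
  I : Set ℝ

/-- The relation between two consecutive stages. -/
structure ConjugationStage.Step (γ ψ ξ₀ : ℝ → ℝ) (j : ℕ → ℤ) (r : ℕ → ℚ) (k : ℕ)
    (S S' : ConjugationStage) : Prop where
  q_lt : S.q < S'.q
  odd : Odd S'.q
  n_lt : S.n < S'.n
  Φ_eq : S'.Φ = kickAt γ S'.q (wSeq S'.n) (j S'.n) ∘ S.Φ
  cantor : CantorStep S.I S'.I (k + 1) (r (k + 1))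
  diffeo_le : ∀ i ≤ k + 2, ∀ t,
    |iteratedDeriv i (fun t => S'.Φ t - S.Φ t) t| ≤ (2 : ℝ) ^ (-((k + 1 : ℕ) : ℤ) - 1)
  field_le : ∀ i ≤ 1, ∀ x ∈ Ici (0 : ℝ), |iteratedDerivWithin i (fun x =>
    conjField ξ₀ ψ S'.Φ x - conjField ξ₀ ψ S.Φ x) (Ici 0) x| ≤ (2 : ℝ) ^ (-((k + 1 : ℕ) : ℤ))
  flow_le : ∀ s ∈ S'.I ∪ {1}, ∀ i ≤ k + 1, ∀ x ∈ Ici (0 : ℝ), |iteratedDerivWithin i (fun x =>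
    conjFlow ψ S'.Φ s x - conjFlow ψ S.Φ s x) (Ici 0) x| ≤ (2 : ℝ) ^ (-((k + 1 : ℕ) : ℤ))

theorem TimeChart.exists_stages {γ ξ₀ ψ : ℝ → ℝ} (hc : TimeChart ξ₀ ψ)
    (hγ : ∀ t : ℝ, t ∉ Icc (-(1 / 4) : ℝ) (1 / 4) → γ t = 0)
    (hs : ContDiff ℝ ((⊤ : ℕ∞) : WithTop ℕ∞) γ) {j : ℕ → ℤ}
    (hj : ∀ T : ℝ, ∀ᶠ n in atTop, T ≤ j n - 1)
    (haff : ∀ᶠ n in atTop, ∀ τ ∈ Icc (-1 : ℝ) 2, ψ (j n + τ) = ψ (j n) - vSeq n * τ)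
    (r : ℕ → ℚ) :
    ∃ u : ℕ → ConjugationStage, u 0 = ⟨1, 4, id, Icc 0 1⟩ ∧
      ∀ k, TameDiffeo (u k).Φ ∧ ConjugationStage.Step γ ψ ξ₀ j r k (u k) (u (k + 1)) := by
  obtain ⟨u, h0, hu⟩ := exists_seq_of_step (x₀ := (⟨1, 4, id, Icc 0 1⟩ : ConjugationStage))
    (P := fun k S => TameDiffeo S.Φ ∧ IsDyadicIntervalUnion k S.I)
    (R := fun k S S' => ConjugationStage.Step γ ψ ξ₀ j r k S S')
    ⟨tameDiffeo_id, isDyadicIntervalUnion_zero⟩ (by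
      rintro k S ⟨hΦ, hI⟩
      have hpow : (2 : ℝ) ^ (-((k + 1 : ℕ) : ℤ)) = 2 * 2 ^ (-((k + 1 : ℕ) : ℤ) - 1) := by
        rw [mul_comm, ← zpow_add_one₀ two_ne_zero, sub_add_cancel]
      have hε : (0 : ℝ) < 2 ^ (-((k + 1 : ℕ) : ℤ) - 1) := zpow_pos two_pos _
      obtain ⟨q, n, I', hq, hodd, hn, hstep, hI', hT, h0, h1, h2⟩ :=
        hc.exists_step hγ hs hΦ hj haff hI S.q S.n (r (k + 1)) (k + 2) hε
      exact ⟨⟨q, n, kickAt γ q (wSeq n) (j n) ∘ S.Φ, I'⟩, ⟨hT, hI'⟩, hq, hodd, hn, rfl, hstep, h0,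
        fun i hi x hx => (h1 i hi x hx).trans (by linarith),
        fun s hs i hi x hx => (h2 s hs i (by omega) x hx).trans hpow.ge⟩)
  exact ⟨u, h0, fun k => ⟨(hu k).1.1, (hu k).2⟩⟩

/-- The inductive construction lemma: there are increasing sequences of positive integers
`q_k` (odd) and `n_k`, and compact sets `I_k` realizing the Cantor-set steps, such that the
associated conjugations `Φ_k`, `h_k`, the pulled-back fields `ξ_k = h_k^*ξ₀` and their flows
`f_k^t` satisfy the estimates (i), (ii), (iii) for every `k ≥ 1`. -/
theorem statement3 (α β ξ₀ : ℝ → ℝ) (hαβ : IsBumpPair α β)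
    (hξ₀ : IsSergeraertField α β ξ₀)
    (hξ₀_smooth : ContDiffOn ℝ ((⊤ : ℕ∞) : WithTop ℕ∞) ξ₀ (Set.Ici 0))
    (hξ₀_neg : ∀ x : ℝ, 0 < x → ξ₀ x < 0)
    (F₀ : ℝ → ℝ → ℝ) (hF₀ : IsFlowOf ξ₀ F₀)
    (ψ : ℝ → ℝ) (hψ : ∀ t : ℝ, ψ t = F₀ t 1)
    (hψ_bij : Set.BijOn ψ Set.univ (Set.Ioi 0))
    (a : ℤ → ℝ) (ha : ∀ l : ℤ, a l = ψ (l : ℝ))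
    (j : ℕ → ℤ)
    (hj : ∀ n : ℕ, 4 ≤ n →
      (2 : ℝ) ^ (-(n : ℤ) - 1) + (2 : ℝ) ^ (-(n : ℤ) - 1) / 3 ≤ a (j n + 2) ∧
      a (j n + 2) < a (j n - 1) ∧
      a (j n - 1) ≤ (2 : ℝ) ^ (-(n : ℤ)) - (2 : ℝ) ^ (-(n : ℤ) - 1) / 3)
    (γ : ℝ → ℝ) (hγ_smooth : ContDiff ℝ ((⊤ : ℕ∞) : WithTop ℕ∞) γ)
    (hγ_range : ∀ t : ℝ, γ t ∈ Set.Icc (0 : ℝ) 1)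
    (hγ_supp : ∀ t : ℝ, t ∉ Set.Icc (-(1 / 4) : ℝ) (1 / 4) → γ t = 0)
    (hγ_zero : ∀ᶠ t in 𝓝 (0 : ℝ), γ t = t ^ 2 / 2)
    (r : ℕ → ℚ) (hr : Function.Surjective r) :
    ∃ (q n : ℕ → ℕ) (I : ℕ → Set ℝ),
      StrictMono q ∧ StrictMono n ∧
      (∀ k, 0 < q k) ∧ (∀ k, 1 ≤ k → Odd (q k)) ∧ (∀ k, 4 ≤ n k) ∧
      I 0 = Set.Icc 0 1 ∧
      ∃ (Φ h ξv : ℕ → ℝ → ℝ) (F : ℕ → ℝ → ℝ → ℝ),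
        ConstructionData γ ψ ξ₀ j q n Φ h ξv F ∧
        (∀ k : ℕ, CrHalfLineDiffeo ⊤ (h k) ∧ ∀ᶠ x in 𝓝[≥] (0 : ℝ), h k x = x) ∧
        ∀ k : ℕ, 1 ≤ k →
          CantorStep (I (k - 1)) (I k) k ((r k : ℝ)) ∧
          ConstructionEstimates Φ ξv F I k := by
  have hc : TimeChart ξ₀ ψ :=
    ⟨hξ₀_smooth, hξ₀.1, hξ₀_neg, hξ₀.2.1, fun t => by
      obtain rfl : ψ = fun s => F₀ s 1 := funext hψ
      exact ((hF₀ 1 (mem_Ici.2 zero_le_one)).2 t).2, hψ_bij⟩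
  have hj' : ∀ T : ℝ, ∀ᶠ n in atTop, T ≤ j n - 1 :=
    hc.eventually_le_of_apply_le <| (eventually_ge_atTop 4).mono fun n hn => by
      have h := (hj n hn).2.2
      rw [ha] at h
      push_cast at h
      have : (0 : ℝ) < 2 ^ (-(n : ℤ) - 1) := zpow_pos two_pos _
      linarith
  have haff : ∀ᶠ n in atTop, ∀ τ ∈ Icc (-1 : ℝ) 2, ψ (j n + τ) = ψ (j n) - vSeq n * τ :=
    (eventually_ge_atTop 4).mono fun n hn τ hτ => by
      obtain ⟨h1, -, h3⟩ := hj n hn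
      rw [ha] at h1 h3
      push_cast at h1 h3
      exact hc.apply_add_of_plateau
        (fun x hx => hξ₀.eq_neg_vSeq hαβ n ⟨h1.trans hx.1, hx.2.trans h3⟩) hτ
  obtain ⟨u, hu0, hu⟩ := hc.exists_stages hγ_supp hγ_smooth hj' haff r
  have hstep := fun k => (hu k).2
  have hq : StrictMono fun k => (u k).q := strictMono_nat_of_lt_succ fun k => (hstep k).q_lt
  have hn : StrictMono fun k => (u k).n := strictMono_nat_of_lt_succ fun k => (hstep k).n_lt
  have hq0 : (u 0).q = 1 := by rw [hu0]
  have hn0 : (u 0).n = 4 := by rw [hu0]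
  refine ⟨fun k => (u k).q, fun k => (u k).n, fun k => (u k).I, hq, hn,
    fun k => lt_of_lt_of_le (by simp [hq0]) (hq.monotone k.zero_le), ?_,
    fun k => hn0.ge.trans (hn.monotone k.zero_le), by simp only [hu0],
    fun k => (u k).Φ, fun k => conjHalfLine ψ (u k).Φ, fun k => conjField ξ₀ ψ (u k).Φ,
    fun k => conjFlow ψ (u k).Φ,
    ⟨by simp only [hu0], fun k => (hstep k).Φ_eq,
      fun k => ⟨conjHalfLine_zero ψ _, hc.conj_apply _⟩, fun _ _ _ => rfl,
      fun k => hc.isFlowOf_conjFlow (hu k).1⟩,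
    fun k => ⟨hc.crHalfLineDiffeo_conj (hu k).1, hc.conj_eventually_eq_self (hu k).1.ident⟩, ?_⟩
  · rintro (_ | k) hk
    · exact absurd hk (by norm_num)
    · exact (hstep k).odd
  · rintro (_ | k) hk
    · exact absurd hk (by norm_num)
    · exact ⟨(hstep k).cantor, (hstep k).diffeo_le, (hstep k).field_le, (hstep k).flow_le⟩
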